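/- Let A and B be prime C*-algebras. Then the Banach *-algebra projective tensor product A ⊗̂ B is prime, i.e., whenever I₁ and I₂ are two-sided ideals of A ⊗̂ B with I₁I₂ = {0}, then I₁ = {0} or I₂ = {0}. -/

import Mathlib

open Pointwise

universe u

/-- The Banach `*`-algebra projective tensor product `A ⊗̂ B` of two C*-algebras, presented
by its characteristic properties: a Banach `*`-algebra `T` with a bilinear map
`tmul : A × B → T` which is multiplicative and `*`-preserving on elementary tensors, has
dense linear span, satisfies `‖a ⊗ b‖ = ‖a‖‖b‖`, and enjoys the universal property of the
projective tensor norm: every bounded bilinear map into a Banach space extends to a bounded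
linear map on `T` without increase of norm. -/
structure CStarProjTensor (A B : Type u)
    [NonUnitalCStarAlgebra A] [NonUnitalCStarAlgebra B] : Type (u + 1) where
  /-- The underlying Banach `*`-algebra `A ⊗̂ B`. -/
  T : Type u
  [ring : NonUnitalNormedRing T]
  [starT : StarRing T]
  [nsg : NormedStarGroup T]
  [mod : NormedSpace ℂ T]
  [tower : IsScalarTower ℂ T T]
  [scomm : SMulCommClass ℂ T T]
  [complete : CompleteSpace T]
  /-- The canonical bilinear map `(a, b) ↦ a ⊗ b`. -/
  tmul : A →ₗ[ℂ] B →ₗ[ℂ] T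
  tmul_mul : ∀ a₁ a₂ b₁ b₂, tmul a₁ b₁ * tmul a₂ b₂ = tmul (a₁ * a₂) (b₁ * b₂)
  tmul_star : ∀ a b, star (tmul a b) = tmul (star a) (star b)
  norm_tmul : ∀ a b, ‖tmul a b‖ = ‖a‖ * ‖b‖
  span_dense : closure (Submodule.span ℂ {t : T | ∃ a b, t = tmul a b} : Set T) = Set.univ
  lift : ∀ (X : Type u) [NormedAddCommGroup X] [NormedSpace ℂ X] [CompleteSpace X]
      (β : A →L[ℂ] B →L[ℂ] X),
    ∃ L : T →L[ℂ] X, (∀ a b, L (tmul a b) = β a b) ∧ ‖L‖ ≤ ‖β‖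

attribute [instance] CStarProjTensor.ring CStarProjTensor.starT CStarProjTensor.nsg
  CStarProjTensor.mod CStarProjTensor.tower CStarProjTensor.scomm CStarProjTensor.complete

/-- A two-sided (ring-theoretic) ideal is prime if whenever a product of two two-sided
ideals is contained in it, one of them is contained in it. -/
def TwoSidedIdeal.IsPrimeTS {R : Type*} [NonUnitalNonAssocRing R]
    (P : TwoSidedIdeal R) : Prop :=
  ∀ I₁ I₂ : TwoSidedIdeal R, (∀ x ∈ I₁, ∀ y ∈ I₂, x * y ∈ P) → I₁ ≤ P ∨ I₂ ≤ P

open scoped ComplexStarModule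

section UnitaryParts

variable {A : Type*} [CStarAlgebra A] [PartialOrder A] [StarOrderedRing A]

open Complex in
/-- A self-adjoint contraction `h` is the imaginary part of two unitaries whose real part
`c` is close to `1`. -/
theorem exists_unitary_real_part {h : A} (hh : IsSelfAdjoint h) (h1 : ‖h‖ ≤ 1) :
    ∃ c : A, IsSelfAdjoint c ∧ 0 ≤ c ∧ c ≤ 1 ∧ 1 - c ≤ h * h ∧
      (1 - c) * (1 - c) ≤ h * h ∧ ‖1 - c‖ ≤ ‖h‖ ^ 2 ∧ ‖c‖ ≤ 1 ∧
      c + I • h ∈ unitary A ∧ c - I • h ∈ unitary A ∧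
      h + I • c ∈ unitary A ∧ h - I • c ∈ unitary A := by
  have hu := hh.self_add_I_smul_cfcSqrt_sub_sq_mem_unitary h h1
  set c := CFC.sqrt (1 - h ^ 2) with hc
  have hc0 : 0 ≤ c := CFC.sqrt_nonneg _
  have hcs : IsSelfAdjoint c := IsSelfAdjoint.of_nonneg hc0
  have hh2 : h ^ 2 ≤ 1 := by
    have : ‖h ^ 2‖ ≤ 1 := by
      calc ‖h ^ 2‖ ≤ ‖h‖ ^ 2 := norm_pow_le' h (by norm_num)
        _ ≤ 1 := pow_le_one₀ (norm_nonneg _) h1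
    exact (CStarAlgebra.norm_le_one_iff_of_nonneg _ (hh.sq_nonneg)).1 this
  have hcc : c * c = 1 - h * h := by
    rw [hc, CFC.sqrt_mul_sqrt_self (1 - h ^ 2) (sub_nonneg.2 hh2), sq]
  have hc1 : c ≤ 1 := by
    have : ‖c‖ * ‖c‖ ≤ 1 := by
      rw [← CStarRing.norm_star_mul_self, hcs.star_eq, hcc]
      refine (CStarAlgebra.norm_le_one_iff_of_nonneg _ ?_).2 ?_
      · rw [← sq]; exact sub_nonneg.2 hh2
      · rw [sub_le_self_iff]; simpa [hh.star_eq] using star_mul_self_nonneg h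
    refine (CStarAlgebra.norm_le_one_iff_of_nonneg _ hc0).1 ?_
    nlinarith [norm_nonneg c]
  have hsq : ∀ x : A, 0 ≤ x → x ≤ 1 → x * x ≤ x := fun x h0 h1 => by
    simpa [sq] using CStarAlgebra.pow_antitone h0 h1 (show 1 ≤ 2 by norm_num)
  have k1 : 1 - c ≤ h * h := by
    have := hsq c hc0 hc1
    rw [hcc] at this
    rw [sub_le_iff_le_add] at this ⊢
    rwa [add_comm]
  have k2 : (1 - c) * (1 - c) ≤ 1 - c := hsq _ (sub_nonneg.2 hc1) (sub_le_self _ hc0)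
  have hus : star (h + I • c) = h - I • c := by
    simp [star_smul, hh.star_eq, hcs.star_eq, sub_eq_add_neg]
  have hu' : h - I • c ∈ unitary A := hus ▸ Unitary.star_mem hu
  have hI : ∀ (z : ℂ) (u : A), star z * z = 1 → u ∈ unitary A → z • u ∈ unitary A := by
    intro z u hz hu
    have hz' : z * star z = 1 := by rw [mul_comm]; exact hz
    constructor
    · rw [star_smul, smul_mul_smul_comm, hz, hu.1, one_smul]
    · rw [star_smul, smul_mul_smul_comm, hz', hu.2, one_smul]
  refine ⟨c, hcs, hc0, hc1, k1, k2.trans k1, ?_, ?_, ?_, ?_, hu, hu'⟩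
  · refine (CStarAlgebra.norm_le_norm_of_nonneg_of_le (sub_nonneg.2 hc1) k1).trans ?_
    rw [sq]; exact norm_mul_le _ _
  · exact (CStarAlgebra.norm_le_one_iff_of_nonneg _ hc0).2 hc1
  · convert hI I _ (by simp) hu' using 1
    rw [smul_sub, smul_smul, I_mul_I]; simp [add_comm]
  · convert hI (-I) _ (by simp) hu using 1
    rw [smul_add, smul_smul, neg_mul, I_mul_I]; simp [sub_eq_add_neg, add_comm]

end UnitaryParts

section NormalizedForm

variable {A B : Type*} [CStarAlgebra A] [PartialOrder A] [StarOrderedRing A]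
  [CStarAlgebra B] [PartialOrder B] [StarOrderedRing B]

/-- A bilinear form bounded by `1` on pairs of unitaries and attaining this bound at `(1, 1)`. -/
structure IsNormalizedForm {A B : Type*} [CStarAlgebra A] [CStarAlgebra B]
    (V : A →ₗ[ℂ] B →ₗ[ℂ] ℂ) : Prop where
  norm_le : ∀ u ∈ unitary A, ∀ v ∈ unitary B, ‖V u v‖ ≤ 1
  map_one : V 1 1 = 1

namespace IsNormalizedForm

open Complex

variable {V : A →ₗ[ℂ] B →ₗ[ℂ] ℂ}

theorem flip {A B : Type*} [CStarAlgebra A] [CStarAlgebra B] {V : A →ₗ[ℂ] B →ₗ[ℂ] ℂ}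
    (hV : IsNormalizedForm V) : IsNormalizedForm V.flip :=
  ⟨fun u hu v hv => hV.norm_le v hv u hu, hV.map_one⟩

theorem norm_le_left {A B : Type*} [CStarAlgebra A] [PartialOrder A] [StarOrderedRing A]
    [CStarAlgebra B] {V : A →ₗ[ℂ] B →ₗ[ℂ] ℂ}
    (hV : IsNormalizedForm V) {s : A} (hs : IsSelfAdjoint s) (h1 : ‖s‖ ≤ 1)
    {v : B} (hv : v ∈ unitary B) : ‖V s v‖ ≤ 1 := by
  obtain ⟨c, -, -, -, -, -, -, -, -, -, u1, u2⟩ := exists_unitary_real_part hs h1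
  have e : (2 : ℂ) * V s v = V (s + I • c) v + V (s - I • c) v := by
    simp only [map_add, map_sub, LinearMap.add_apply, LinearMap.sub_apply]; ring
  have := norm_add_le (V (s + I • c) v) (V (s - I • c) v)
  rw [← e, norm_mul] at this
  have a1 := hV.norm_le _ u1 _ hv
  have a2 := hV.norm_le _ u2 _ hv
  simp only [Complex.norm_ofNat] at this
  linarith

theorem norm_le_of_norm_le_one (hV : IsNormalizedForm V) {s : A} (hs : IsSelfAdjoint s)
    (h1 : ‖s‖ ≤ 1) {v : B} (hv : IsSelfAdjoint v) (hv1 : ‖v‖ ≤ 1) : ‖V s v‖ ≤ 1 := by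
  obtain ⟨c, -, -, -, -, -, -, -, -, -, u1, u2⟩ := exists_unitary_real_part hv hv1
  have e : (2 : ℂ) * V s v = V s (v + I • c) + V s (v - I • c) := by
    simp only [map_add, map_sub]; ring
  have := norm_add_le (V s (v + I • c)) (V s (v - I • c))
  rw [← e, norm_mul] at this
  have a1 := hV.norm_le_left hs h1 u1
  have a2 := hV.norm_le_left hs h1 u2
  simp only [Complex.norm_ofNat] at this
  linarith

theorem norm_le_mul (hV : IsNormalizedForm V) {s : A} (hs : IsSelfAdjoint s)
    {v : B} (hv : IsSelfAdjoint v) : ‖V s v‖ ≤ ‖s‖ * ‖v‖ := by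
  rcases eq_or_ne s 0 with rfl | h0
  · simp
  rcases eq_or_ne v 0 with rfl | h0'
  · simp
  have hn : 0 < ‖s‖ := norm_pos_iff.2 h0
  have hn' : 0 < ‖v‖ := norm_pos_iff.2 h0'
  have key := hV.norm_le_of_norm_le_one (s := (‖s‖⁻¹ : ℝ) • s) (v := (‖v‖⁻¹ : ℝ) • v)
    ((IsSelfAdjoint.all _).smul hs) (by simp [norm_smul, hn.ne'])
    ((IsSelfAdjoint.all _).smul hv) (by simp [norm_smul, hn'.ne'])
  rw [LinearMap.map_smul_of_tower, LinearMap.map_smul_of_tower, LinearMap.smul_apply, norm_smul,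
    norm_smul] at key
  simp only [norm_inv, norm_norm] at key
  field_simp at key
  linarith

theorem re_nonneg {A B : Type*} [CStarAlgebra A] [PartialOrder A] [StarOrderedRing A]
    [CStarAlgebra B] {V : A →ₗ[ℂ] B →ₗ[ℂ] ℂ}
    (hV : IsNormalizedForm V) {q : A} (hq : 0 ≤ q) : 0 ≤ (V q 1).re := by
  have hqs : IsSelfAdjoint q := .of_nonneg hq
  have key : ∀ p : A, 0 ≤ p → p ≤ 1 → 0 ≤ (V p 1).re := by
    intro p h0 h1
    have hps : IsSelfAdjoint p := .of_nonneg h0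
    have hs : IsSelfAdjoint (1 - (2 : ℝ) • p) :=
      (IsSelfAdjoint.one A).sub ((IsSelfAdjoint.all _).smul hps)
    have hn : ‖1 - (2 : ℝ) • p‖ ≤ 1 := by
      have hp2 : p * p ≤ p := by
        simpa [sq] using CStarAlgebra.pow_antitone h0 h1 (show 1 ≤ 2 by norm_num)
      have e : (1 - (2 : ℝ) • p) * (1 - (2 : ℝ) • p) = 1 - (4 : ℝ) • (p - p * p) := by
        simp only [sub_mul, mul_sub, one_mul, mul_one, smul_mul_smul_comm, smul_sub]
        module
      have hle : (1 - (2 : ℝ) • p) * (1 - (2 : ℝ) • p) ≤ 1 := by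
        rw [e, sub_le_self_iff]
        exact smul_nonneg (by norm_num) (sub_nonneg.2 hp2)
      have h00 : 0 ≤ (1 - (2 : ℝ) • p) * (1 - (2 : ℝ) • p) := by
        have := star_mul_self_nonneg (1 - (2 : ℝ) • p)
        rwa [hs.star_eq] at this
      have := (CStarAlgebra.norm_le_one_iff_of_nonneg _ h00).2 hle
      have h3 : ‖1 - (2 : ℝ) • p‖ * ‖1 - (2 : ℝ) • p‖ ≤ 1 := by
        rw [← CStarRing.norm_star_mul_self, hs.star_eq]; exact this
      nlinarith [norm_nonneg (1 - (2 : ℝ) • p)]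
    have := hV.norm_le_left hs hn (one_mem (unitary B))
    have h2 := (Complex.re_le_norm _).trans this
    rw [map_sub, LinearMap.sub_apply, hV.map_one, LinearMap.map_smul_of_tower,
      LinearMap.smul_apply] at h2
    simp only [Complex.sub_re, Complex.one_re, Complex.real_smul, Complex.mul_re,
      Complex.ofReal_re, Complex.ofReal_im] at h2
    linarith
  have hn : 0 < ‖q‖ + 1 := by positivity
  have h1 := key ((‖q‖ + 1)⁻¹ • q) (smul_nonneg (by positivity) hq) (by
    refine (CStarAlgebra.norm_le_one_iff_of_nonneg _ (smul_nonneg (by positivity) hq)).1 ?_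
    rw [norm_smul, norm_inv, Real.norm_of_nonneg hn.le, inv_mul_le_iff₀ hn]
    linarith)
  rw [LinearMap.map_smul_of_tower, LinearMap.smul_apply] at h1
  simp only [Complex.real_smul, Complex.mul_re, Complex.ofReal_re, Complex.ofReal_im, zero_mul,
    sub_zero] at h1
  exact nonneg_of_mul_nonneg_right h1 (by positivity)

theorem re_mono {A B : Type*} [CStarAlgebra A] [PartialOrder A] [StarOrderedRing A]
    [CStarAlgebra B] {V : A →ₗ[ℂ] B →ₗ[ℂ] ℂ}
    (hV : IsNormalizedForm V) {q p : A} (h : q ≤ p) : (V q 1).re ≤ (V p 1).re := by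
  have := hV.re_nonneg (sub_nonneg.2 h)
  rw [map_sub, LinearMap.sub_apply, Complex.sub_re] at this
  linarith

theorem abs_re_le (hV : IsNormalizedForm V) {h : A} (hh : IsSelfAdjoint h)
    {k : B} (hk : IsSelfAdjoint k) :
    |(V h k).re| ≤ (V (h * h) 1).re + (V 1 (k * k)).re := by
  have step : ∀ r : ℝ, 0 < r → r * ‖h‖ ≤ 1 → r * ‖k‖ ≤ 1 →
      |(V h k).re| ≤ (V (h * h) 1).re + (V 1 (k * k)).re + r ^ 2 * (‖h‖ ^ 2 * ‖k‖ ^ 2) := by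
    intro r hr h1 h2
    have nh : ‖r • h‖ = r * ‖h‖ := by rw [norm_smul, Real.norm_of_nonneg hr.le]
    have nk : ‖r • k‖ = r * ‖k‖ := by rw [norm_smul, Real.norm_of_nonneg hr.le]
    obtain ⟨c, cs, c0, c1, cle, -, cn, -, u1, u2, -, -⟩ :=
      exists_unitary_real_part (h := r • h) ((IsSelfAdjoint.all _).smul hh) (nh ▸ h1)
    obtain ⟨d, ds, d0, d1, dle, -, dn, -, v1, v2, -, -⟩ :=
      exists_unitary_real_part (h := r • k) ((IsSelfAdjoint.all _).smul hk) (nk ▸ h2)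
    have e1 : V (c + I • (r • h)) (d + I • (r • k)) + V (c - I • (r • h)) (d - I • (r • k)) =
        2 * (V c d - r ^ 2 * V h k) := by
      simp only [map_add, map_sub, LinearMap.add_apply, LinearMap.sub_apply, map_smul,
        LinearMap.smul_apply, LinearMap.map_smul_of_tower, smul_eq_mul, Complex.real_smul]
      linear_combination (2 * r ^ 2 * V h k) * Complex.I_sq
    have e2 : V (c + I • (r • h)) (d - I • (r • k)) + V (c - I • (r • h)) (d + I • (r • k)) =
        2 * (V c d + r ^ 2 * V h k) := by
      simp only [map_add, map_sub, LinearMap.add_apply, LinearMap.sub_apply, map_smul,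
        LinearMap.smul_apply, LinearMap.map_smul_of_tower, smul_eq_mul, Complex.real_smul]
      linear_combination (-2 * r ^ 2 * V h k) * Complex.I_sq
    have re_le : ∀ u ∈ unitary A, ∀ v ∈ unitary B, (V u v).re ≤ 1 := fun u hu v hv =>
      (Complex.re_le_norm _).trans (hV.norm_le u hu v hv)
    have f1 := congrArg Complex.re e1
    have f2 := congrArg Complex.re e2
    have hre : ∀ z w : ℂ, (2 * (z - (r : ℂ) ^ 2 * w)).re = 2 * (z.re - r ^ 2 * w.re) ∧
        (2 * (z + (r : ℂ) ^ 2 * w)).re = 2 * (z.re + r ^ 2 * w.re) := by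
      intro z w; constructor <;> simp [← Complex.ofReal_pow]
    rw [Complex.add_re, (hre _ _).1] at f1
    rw [Complex.add_re, (hre _ _).2] at f2
    have b1 := re_le _ u1 _ v1
    have b2 := re_le _ u2 _ v2
    have b3 := re_le _ u1 _ v2
    have b4 := re_le _ u2 _ v1
    have e3 : V c d = 1 - V (1 - c) 1 - V 1 (1 - d) + V (1 - c) (1 - d) := by
      simp only [map_sub, LinearMap.sub_apply, hV.map_one]; ring
    have f3 := congrArg Complex.re e3
    simp only [Complex.sub_re, Complex.add_re, Complex.one_re] at f3
    have g1 : (V (1 - c) 1).re ≤ r ^ 2 * (V (h * h) 1).re := by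
      have := hV.re_mono cle
      rw [smul_mul_smul_comm, LinearMap.map_smul_of_tower, LinearMap.smul_apply] at this
      simpa [sq] using this
    have g2 : (V 1 (1 - d)).re ≤ r ^ 2 * (V 1 (k * k)).re := by
      have := hV.flip.re_mono dle
      rw [smul_mul_smul_comm, LinearMap.map_smul_of_tower, LinearMap.smul_apply] at this
      simpa [sq] using this
    have g3 : -(V (1 - c) (1 - d)).re ≤ r ^ 2 * (r ^ 2 * (‖h‖ ^ 2 * ‖k‖ ^ 2)) := by
      have a1 := (neg_le_abs _).trans (Complex.abs_re_le_norm (V (1 - c) (1 - d)))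
      have a2 := hV.norm_le_mul ((IsSelfAdjoint.one A).sub cs) ((IsSelfAdjoint.one B).sub ds)
      rw [nh] at cn
      rw [nk] at dn
      have a3 := mul_le_mul cn dn (norm_nonneg _) (by positivity)
      calc _ ≤ _ := a1
        _ ≤ _ := a2
        _ ≤ _ := a3
        _ = _ := by ring
    have hr2 : 0 < r ^ 2 := by positivity
    refine le_of_mul_le_mul_left ?_ hr2
    rcases abs_cases (V h k).re with ⟨h', -⟩ | ⟨h', -⟩ <;> rw [h'] <;> nlinarith
  refine le_of_tendsto_of_tendsto' (f := fun n : ℕ => |(V h k).re|)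
    (g := fun n : ℕ => (V (h * h) 1).re + (V 1 (k * k)).re +
      (1 / ((n : ℝ) + 1) * (‖h‖ + ‖k‖ + 1)⁻¹) ^ 2 * (‖h‖ ^ 2 * ‖k‖ ^ 2))
    (b := Filter.atTop) tendsto_const_nhds ?_ ?_
  · have := (((tendsto_one_div_add_atTop_nhds_zero_nat (𝕜 := ℝ)).mul_const
      (‖h‖ + ‖k‖ + 1)⁻¹).pow 2).mul_const (‖h‖ ^ 2 * ‖k‖ ^ 2)
    simpa using this.const_add ((V (h * h) 1).re + (V 1 (k * k)).re)
  · intro n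
    have hp : 0 < ‖h‖ + ‖k‖ + 1 := by positivity
    have hn : 1 / ((n : ℝ) + 1) ≤ 1 := by
      rw [div_le_one (by positivity)]; simp
    have hb : ∀ x : ℝ, 0 ≤ x → x ≤ ‖h‖ + ‖k‖ + 1 →
        1 / ((n : ℝ) + 1) * (‖h‖ + ‖k‖ + 1)⁻¹ * x ≤ 1 := by
      intro x hx hx'
      rw [mul_assoc]
      refine mul_le_one₀ hn (by positivity) ?_
      rwa [inv_mul_le_iff₀ hp, mul_one]
    exact step _ (by positivity) (hb _ (norm_nonneg _) (by linarith [norm_nonneg k]))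
      (hb _ (norm_nonneg _) (by linarith [norm_nonneg h]))

theorem re_real_smul {A B : Type*} [CStarAlgebra A] [CStarAlgebra B] {V : A →ₗ[ℂ] B →ₗ[ℂ] ℂ}
    (r : ℝ) (a : A) (b : B) : (V (r • a) b).re = r * (V a b).re := by
  rw [LinearMap.map_smul_of_tower, LinearMap.smul_apply]; simp

/-- A version of `exists_unitary_real_part` for the rescaled element `t • h`. -/
theorem im_le_aux {A B : Type*} [CStarAlgebra A] [PartialOrder A] [StarOrderedRing A]
    [CStarAlgebra B] {V : A →ₗ[ℂ] B →ₗ[ℂ] ℂ}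
    (hV : IsNormalizedForm V) {h : A} (hh : IsSelfAdjoint h) {t : ℝ}
    (ht : ‖t • h‖ ≤ 1) : ∃ c : A, IsSelfAdjoint c ∧ 0 ≤ 1 - c ∧
      (V (1 - c) 1).re ≤ t ^ 2 * (V (h * h) 1).re ∧
      (V ((1 - c) * (1 - c)) 1).re ≤ t ^ 2 * (V (h * h) 1).re ∧
      c + I • (t • h) ∈ unitary A ∧ c - I • (t • h) ∈ unitary A := by
  obtain ⟨c, cs, c0, c1, cle, cle', cn, -, u1, u2, -, -⟩ :=
    exists_unitary_real_part (h := t • h) ((IsSelfAdjoint.all _).smul hh) ht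
  refine ⟨c, cs, sub_nonneg.2 c1, ?_, ?_, u1, u2⟩
  · have := hV.re_mono cle
    rwa [smul_mul_smul_comm, re_real_smul, ← sq] at this
  · have := hV.re_mono cle'
    rwa [smul_mul_smul_comm, re_real_smul, ← sq t] at this

theorem im_map_one {A B : Type*} [CStarAlgebra A] [PartialOrder A] [StarOrderedRing A]
    [CStarAlgebra B] {V : A →ₗ[ℂ] B →ₗ[ℂ] ℂ}
    (hV : IsNormalizedForm V) {h : A} (hh : IsSelfAdjoint h) :
    (V h 1).im = 0 := by
  have step : ∀ t : ℝ, 0 < t → t * ‖h‖ ≤ 1 → |(V h 1).im| ≤ t * (V (h * h) 1).re := by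
    intro t ht h1
    obtain ⟨c, -, -, c1, -, u1, u2⟩ := hV.im_le_aux (t := t) hh (by
      rwa [norm_smul, Real.norm_of_nonneg ht.le])
    have b1 := (Complex.re_le_norm _).trans (hV.norm_le _ u1 _ (one_mem _))
    have b2 := (Complex.re_le_norm _).trans (hV.norm_le _ u2 _ (one_mem _))
    rw [map_sub, LinearMap.sub_apply, hV.map_one] at c1
    simp only [map_add, map_sub, LinearMap.add_apply, LinearMap.sub_apply, map_smul,
        LinearMap.smul_apply, LinearMap.map_smul_of_tower, smul_eq_mul, Complex.real_smul] at b1 b2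
    simp at b1 b2 c1
    refine le_of_mul_le_mul_left ?_ ht
    rcases abs_cases (V h 1).im with ⟨h', -⟩ | ⟨h', -⟩ <;> rw [h'] <;> nlinarith
  have : |(V h 1).im| ≤ 0 := by
    refine le_of_tendsto_of_tendsto' (f := fun n : ℕ => |(V h 1).im|)
      (g := fun n : ℕ => (1 / ((n : ℝ) + 1) * (‖h‖ + 1)⁻¹) * (V (h * h) 1).re)
      (b := Filter.atTop) tendsto_const_nhds ?_ ?_
    · simpa using ((tendsto_one_div_add_atTop_nhds_zero_nat (𝕜 := ℝ)).mul_const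
        (‖h‖ + 1)⁻¹).mul_const (V (h * h) 1).re
    · intro n
      have hp : 0 < ‖h‖ + 1 := by positivity
      refine step _ (by positivity) ?_
      rw [mul_assoc]
      refine mul_le_one₀ ?_ (by positivity) ?_
      · rw [div_le_one (by positivity)]; simp
      · rw [inv_mul_le_iff₀ hp]; linarith
  exact abs_nonpos_iff.1 this

theorem abs_im_le (hV : IsNormalizedForm V) {h : A} (hh : IsSelfAdjoint h) (h1 : ‖h‖ ≤ 1)
    {p : B} (hp0 : 0 ≤ p) (hp1 : p ≤ 1) {t : ℝ} (ht0 : 0 < t) (ht1 : t ≤ 1) :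
    t * |(V h p).im| ≤ 3 / 2 * t ^ 2 * (V (h * h) 1).re + 2 * (V 1 p).re := by
  have hps : IsSelfAdjoint p := .of_nonneg hp0
  have hp2 : p * p ≤ p := by
    simpa [sq] using CStarAlgebra.pow_antitone hp0 hp1 (show 1 ≤ 2 by norm_num)
  obtain ⟨c, cs, -, c1, c2, u1, u2⟩ := hV.im_le_aux (t := t) hh (by
      rw [norm_smul, Real.norm_of_nonneg ht0.le]; exact mul_le_one₀ ht1 (norm_nonneg _) h1)
  have hd : IsSelfAdjoint (1 - (2 : ℝ) • p) :=
    (IsSelfAdjoint.one B).sub ((IsSelfAdjoint.all _).smul hps)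
  have hdn : ‖1 - (2 : ℝ) • p‖ ≤ 1 := by
    have e : (1 - (2 : ℝ) • p) * (1 - (2 : ℝ) • p) = 1 - (4 : ℝ) • (p - p * p) := by
      simp only [sub_mul, mul_sub, one_mul, mul_one, smul_mul_smul_comm, smul_sub]
      module
    have hle : (1 - (2 : ℝ) • p) * (1 - (2 : ℝ) • p) ≤ 1 := by
      rw [e, sub_le_self_iff]
      exact smul_nonneg (by norm_num) (sub_nonneg.2 hp2)
    have h00 : 0 ≤ (1 - (2 : ℝ) • p) * (1 - (2 : ℝ) • p) := by
      have := star_mul_self_nonneg (1 - (2 : ℝ) • p)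
      rwa [hd.star_eq] at this
    have := (CStarAlgebra.norm_le_one_iff_of_nonneg _ h00).2 hle
    have h3 : ‖1 - (2 : ℝ) • p‖ * ‖1 - (2 : ℝ) • p‖ ≤ 1 := by
      rw [← CStarRing.norm_star_mul_self, hd.star_eq]; exact this
    nlinarith [norm_nonneg (1 - (2 : ℝ) • p)]
  have b1 := (Complex.re_le_norm _).trans (hV.flip.norm_le_left hd hdn u1)
  have b2 := (Complex.re_le_norm _).trans (hV.flip.norm_le_left hd hdn u2)
  have im1 := hV.im_map_one hh
  have r1 := hV.abs_re_le ((IsSelfAdjoint.one A).sub cs) hps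
  have r2 := hV.flip.re_mono hp2
  simp only [LinearMap.flip_apply] at b1 b2 r2
  rw [map_sub, LinearMap.sub_apply, hV.map_one] at c1
  simp only [map_add, map_sub, LinearMap.add_apply, LinearMap.sub_apply, map_smul,
    LinearMap.smul_apply, LinearMap.map_smul_of_tower, smul_eq_mul, Complex.real_smul] at b1 b2 r1
  simp [im1] at b1 b2 c1 r1
  have r3 := neg_le_of_abs_le r1
  rcases abs_cases (V h p).im with ⟨h', -⟩ | ⟨h', -⟩ <;> rw [h'] <;> nlinarith

theorem norm_le_of_le_one_aux (hV : IsNormalizedForm V) {q : A} (hq0 : 0 ≤ q) (hq1 : q ≤ 1)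
    {p : B} (hp0 : 0 ≤ p) (hp1 : p ≤ 1) {t : ℝ} (ht0 : 0 < t)
    (ht1 : t ≤ 1) :
    ‖V q p‖ ≤ 4 * (t * (V q 1).re + t⁻¹ * (V 1 p).re) := by
  have hqs : IsSelfAdjoint q := .of_nonneg hq0
  have hps : IsSelfAdjoint p := .of_nonneg hp0
  have hp2 : p * p ≤ p := by
    simpa [sq] using CStarAlgebra.pow_antitone hp0 hp1 (show 1 ≤ 2 by norm_num)
  have hq2 : q * q ≤ q := by
    simpa [sq] using CStarAlgebra.pow_antitone hq0 hq1 (show 1 ≤ 2 by norm_num)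
  have i1 := hV.abs_im_le hqs ((CStarAlgebra.norm_le_one_iff_of_nonneg _ hq0).2 hq1)
    hp0 hp1 ht0 ht1
  have r1 := hV.abs_re_le (h := t • q) ((IsSelfAdjoint.all _).smul hqs) hps
  rw [re_real_smul, smul_mul_smul_comm, re_real_smul, abs_mul, abs_of_pos ht0] at r1
  have m1 := hV.re_mono hq2
  have m2 := hV.flip.re_mono hp2
  simp only [LinearMap.flip_apply] at m2
  have n1 := hV.re_nonneg hq0
  have n2 := hV.flip.re_nonneg hp0
  simp only [LinearMap.flip_apply] at n2
  have := Complex.norm_le_abs_re_add_abs_im (V q p)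
  refine le_of_mul_le_mul_left ?_ ht0
  have e : t * (4 * (t * (V q 1).re + t⁻¹ * (V 1 p).re)) =
      4 * (t ^ 2 * (V q 1).re) + 4 * (V 1 p).re := by
    field_simp
  rw [e]
  have t2 : 0 < t ^ 2 := by positivity
  have := mul_le_mul_of_nonneg_left this ht0.le
  have := mul_le_mul_of_nonneg_left m1 t2.le
  nlinarith

theorem norm_le_of_le_one (hV : IsNormalizedForm V) {q : A} (hq0 : 0 ≤ q) (hq1 : q ≤ 1)
    {p : B} (hp0 : 0 ≤ p) (hp1 : p ≤ 1) {t : ℝ} (ht0 : 0 < t) :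
    ‖V q p‖ ≤ 4 * (t * (V q 1).re + t⁻¹ * (V 1 p).re) := by
  rcases le_total t 1 with h | h
  · exact norm_le_of_le_one_aux hV hq0 hq1 hp0 hp1 ht0 h
  · have := norm_le_of_le_one_aux hV.flip hp0 hp1 hq0 hq1 (inv_pos.2 ht0) (inv_le_one_of_one_le₀ h)
    simpa [add_comm] using this

theorem inv_smul_le_one {α : ℝ} (hα : 0 < α) {q : A}
    (hq : q ≤ α • (1 : A)) : α⁻¹ • q ≤ 1 := by
  have := smul_le_smul_of_nonneg_left hq (inv_pos.2 hα).le
  rwa [smul_smul, inv_mul_cancel₀ hα.ne', one_smul] at this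

/-- Scaled version, with the weights chosen so that dyadic sums converge. -/
theorem norm_le_of_le_smul_one (hV : IsNormalizedForm V) {α β : ℝ} (hα : 0 < α) (hβ : 0 < β)
    {q : A} (hq0 : 0 ≤ q) (hq1 : q ≤ α • (1 : A)) {p : B} (hp0 : 0 ≤ p) (hp1 : p ≤ β • (1 : B)) :
    ‖V q p‖ ≤ 4 * (α ^ 2 / β * (V q 1).re + β ^ 2 / α * (V 1 p).re) := by
  have := hV.norm_le_of_le_one (smul_nonneg (inv_pos.2 hα).le hq0) (inv_smul_le_one hα hq1)
    (smul_nonneg (inv_pos.2 hβ).le hp0) (inv_smul_le_one hβ hp1) (t := α ^ 2 / β ^ 2) (by positivity)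
  have e := re_real_smul (V := V.flip) β⁻¹ p 1
  simp only [LinearMap.flip_apply] at e
  rw [re_real_smul, e, LinearMap.map_smul_of_tower, LinearMap.map_smul_of_tower,
    LinearMap.smul_apply, norm_smul, norm_smul, Real.norm_of_nonneg (inv_pos.2 hα).le,
    Real.norm_of_nonneg (inv_pos.2 hβ).le] at this
  have h2 := mul_le_mul_of_nonneg_left this (mul_pos hα hβ).le
  have e1 : α * β * (β⁻¹ * (α⁻¹ * ‖V q p‖)) = ‖V q p‖ := by field_simp
  rw [e1] at h2
  refine h2.trans_eq ?_
  field_simp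

end IsNormalizedForm

end NormalizedForm

section FourthPowers

/-- The slices of height `2 ^ k` of a nonnegative real number. -/
def dyadicSlice : ℕ → ℝ → ℝ
  | 0, t => min t 1
  | k + 1, t => min t (2 ^ (k + 1)) - min t (2 ^ k)

theorem sum_dyadicSlice (N : ℕ) (t : ℝ) :
    ∑ k ∈ Finset.range (N + 1), dyadicSlice k t = min t (2 ^ N) := by
  induction N with
  | zero => simp [dyadicSlice]
  | succ n ih => rw [Finset.sum_range_succ, ih, dyadicSlice]; ring

theorem continuous_dyadicSlice (k : ℕ) : Continuous (dyadicSlice k) := by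
  cases k <;> (unfold dyadicSlice; fun_prop)

theorem dyadicSlice_nonneg {t : ℝ} (ht : 0 ≤ t) (k : ℕ) : 0 ≤ dyadicSlice k t := by
  cases k with
  | zero => exact le_min ht zero_le_one
  | succ k =>
    have : (2 : ℝ) ^ k ≤ 2 ^ (k + 1) := pow_le_pow_right₀ (by norm_num) (Nat.le_succ k)
    exact sub_nonneg.2 (min_le_min_left t this)

theorem dyadicSlice_le {t : ℝ} (ht : 0 ≤ t) (k : ℕ) : dyadicSlice k t ≤ 2 ^ k := by
  cases k with
  | zero => simp [dyadicSlice]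
  | succ k =>
    have : 0 ≤ min t (2 ^ k) := le_min ht (by positivity)
    exact (sub_le_self _ this).trans (min_le_right _ _)

theorem sum_four_pow_mul_dyadicSlice_le {t : ℝ} (ht : 0 ≤ t) (N : ℕ) :
    ∑ k ∈ Finset.range (N + 1), 4 ^ k * dyadicSlice k t ≤ 1 + 8 * t ^ 4 := by
  have : ∑ k ∈ Finset.range (N + 1), 4 ^ k * dyadicSlice k t ≤ 1 + 8 * (min t (2 ^ N)) ^ 4 := by
    induction N with
    | zero =>
      have : 0 ≤ (min t 1) ^ 4 := pow_nonneg (le_min ht zero_le_one) 4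
      simp only [zero_add, Finset.sum_range_one, pow_zero, one_mul, dyadicSlice]
      linarith [min_le_right t 1]
    | succ n ih =>
      rw [Finset.sum_range_succ, dyadicSlice]
      refine (add_le_add_left ih _).trans ?_
      have ha : (1 : ℝ) ≤ 2 ^ n := one_le_pow₀ (by norm_num)
      have h4 : (4 : ℝ) ^ (n + 1) = 4 * (2 ^ n) ^ 2 := by
        rw [pow_succ, ← pow_mul, mul_comm n 2, pow_mul]; norm_num; ring
      rw [h4, pow_succ (2 : ℝ) n]
      generalize (2 : ℝ) ^ n = a at *
      rcases le_total t a with h | h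
      · rw [min_eq_left h, min_eq_left (by linarith)]; simp
      · rw [min_eq_right h]
        have hm : a ≤ min t (a * 2) := le_min h (by linarith)
        generalize min t (a * 2) = m at *
        have e : 8 * m ^ 4 - 8 * a ^ 4 - 4 * a ^ 2 * (m - a) =
          (m - a) * (8 * (m + a) * (m ^ 2 + a ^ 2) - 4 * a ^ 2) := by ring
        have : 0 ≤ 8 * (m + a) * (m ^ 2 + a ^ 2) - 4 * a ^ 2 := by
          have : 8 * a ^ 2 ≤ 8 * (m + a) * (m ^ 2 + a ^ 2) := by
            have : 1 * a ^ 2 ≤ (m + a) * (m ^ 2 + a ^ 2) := by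
              apply mul_le_mul <;> nlinarith
            linarith
          nlinarith
        nlinarith [mul_nonneg (sub_nonneg.2 hm) this]
  refine this.trans ?_
  have h0 : 0 ≤ min t (2 ^ N) := le_min ht (by positivity)
  have := pow_le_pow_left₀ h0 (min_le_left t (2 ^ N)) 4
  linarith

variable {A B : Type*} [CStarAlgebra A] [PartialOrder A] [StarOrderedRing A]
  [CStarAlgebra B] [PartialOrder B] [StarOrderedRing B]

theorem exists_dyadic_decomposition {x : A} (hx : 0 ≤ x) : ∃ (N : ℕ) (D : ℕ → A),
    (∀ k, 0 ≤ D k ∧ D k ≤ (2 ^ k : ℝ) • (1 : A)) ∧ ∑ k ∈ Finset.range N, D k = x ∧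
    ∑ k ∈ Finset.range N, (4 ^ k : ℝ) • D k ≤ 1 + (8 : ℝ) • x ^ 4 := by
  obtain ⟨N, hN⟩ := pow_unbounded_of_one_lt (‖x‖ * ‖(1 : A)‖) (one_lt_two (α := ℝ))
  have hxs : IsSelfAdjoint x := .of_nonneg hx
  have hsp : ∀ t ∈ spectrum ℝ x, 0 ≤ t := fun t ht => spectrum_nonneg_of_nonneg hx ht
  have hc : ∀ k, ContinuousOn (dyadicSlice k) (spectrum ℝ x) :=
    fun k => (continuous_dyadicSlice k).continuousOn
  refine ⟨N + 1, fun k => cfc (dyadicSlice k) x, fun k => ⟨?_, ?_⟩, ?_, ?_⟩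
  · exact cfc_nonneg fun t ht => dyadicSlice_nonneg (hsp t ht) k
  · rw [← Algebra.algebraMap_eq_smul_one, ← cfc_const (2 ^ k : ℝ) x hxs]
    exact cfc_mono (fun t ht => dyadicSlice_le (hsp t ht) k) (hc k) continuousOn_const
  · rw [← cfc_sum _ _ _ (fun k _ => hc k)]
    conv_rhs => rw [← cfc_id ℝ x hxs]
    refine cfc_congr fun t ht => ?_
    have := spectrum.norm_le_norm_mul_of_mem ht
    simp only [Finset.sum_apply, sum_dyadicSlice, id]
    exact min_eq_left ((le_abs_self t).trans (this.trans hN.le))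
  · have e : ∑ k ∈ Finset.range (N + 1), (4 ^ k : ℝ) • cfc (dyadicSlice k) x =
        cfc (∑ k ∈ Finset.range (N + 1), fun t => 4 ^ k * dyadicSlice k t) x := by
      rw [cfc_sum (fun k t => 4 ^ k * dyadicSlice k t) _ _
        (fun k _ => (continuousOn_const.mul (hc k)))]
      refine Finset.sum_congr rfl fun k _ => ?_
      rw [cfc_const_mul _ _ _ (hc k)]
    have e2 : 1 + (8 : ℝ) • x ^ 4 = cfc (fun t : ℝ => 1 + 8 * t ^ 4) x := by
      rw [cfc_const_add _ _ _ (by fun_prop) hxs, cfc_const_mul _ _ _ (by fun_prop),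
        cfc_pow_id x 4 hxs, map_one]
    rw [e, e2]
    refine cfc_mono (fun t ht => ?_) ?_ (by fun_prop)
    · simpa using sum_four_pow_mul_dyadicSlice_le (hsp t ht) N
    · have : (∑ k ∈ Finset.range (N + 1), fun t => 4 ^ k * dyadicSlice k t) =
          fun t => ∑ k ∈ Finset.range (N + 1), 4 ^ k * dyadicSlice k t := by
        ext t; simp
      rw [this]
      exact continuousOn_finsetSum _ fun k _ => continuousOn_const.mul (hc k)

theorem exists_sub_nonneg_pow_four_le {x : A} (hx : IsSelfAdjoint x) : ∃ y z : A,
    0 ≤ y ∧ 0 ≤ z ∧ x = y - z ∧ y ^ 4 ≤ x ^ 4 ∧ z ^ 4 ≤ x ^ 4 := by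
  have hc1 : Continuous fun t : ℝ => max t 0 := by fun_prop
  have hc2 : Continuous fun t : ℝ => max (-t) 0 := by fun_prop
  refine ⟨cfc (fun t : ℝ => max t 0) x, cfc (fun t : ℝ => max (-t) 0) x,
    cfc_nonneg fun t _ => le_max_right _ _, cfc_nonneg fun t _ => le_max_right _ _, ?_, ?_, ?_⟩
  · rw [← cfc_sub _ _ _ hc1.continuousOn hc2.continuousOn]
    conv_lhs => rw [← cfc_id ℝ x hx]
    refine cfc_congr fun t _ => ?_
    rcases le_total t 0 with h | h
    · simp [max_eq_right h, max_eq_left (neg_nonneg.2 h)]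
    · simp [max_eq_left h, max_eq_right (neg_nonpos.2 h)]
  · rw [← cfc_pow _ _ _ hc1.continuousOn]
    conv_rhs => rw [← cfc_pow_id (R := ℝ) x 4 hx]
    refine cfc_mono (fun t _ => ?_) (by fun_prop) (by fun_prop)
    rcases le_total t 0 with h | h
    · simp [max_eq_right h]; positivity
    · simp [max_eq_left h]
  · rw [← cfc_pow _ _ _ hc2.continuousOn]
    conv_rhs => rw [← cfc_pow_id (R := ℝ) x 4 hx]
    refine cfc_mono (fun t _ => ?_) (by fun_prop) (by fun_prop)
    rcases le_total t 0 with h | h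
    · simp [max_eq_left (neg_nonneg.2 h)]
      rw [show t ^ 4 = (-t) ^ 4 by ring]
    · simp [max_eq_right (neg_nonpos.2 h)]; positivity

namespace IsNormalizedForm

variable {V : A →ₗ[ℂ] B →ₗ[ℂ] ℂ}

theorem norm_le_of_nonneg (hV : IsNormalizedForm V) {x : A} (hx : 0 ≤ x) {y : B} (hy : 0 ≤ y) :
    ‖V x y‖ ≤ 8 * ((1 + 8 * (V (x ^ 4) 1).re) + (1 + 8 * (V 1 (y ^ 4)).re)) := by
  obtain ⟨N, D, hD, hDx, hD4⟩ := exists_dyadic_decomposition hx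
  obtain ⟨M, E, hE, hEy, hE4⟩ := exists_dyadic_decomposition hy
  have geom : ∀ N : ℕ, ∑ k ∈ Finset.range N, ((2 : ℝ) ^ k)⁻¹ ≤ 2 := by
    intro N
    have h := sum_geometric_two_le N
    simpa using h
  have b1 := hV.re_mono hD4
  have b2 := hV.flip.re_mono hE4
  simp only [LinearMap.flip_apply] at b2
  have hV1 := hV.map_one
  simp only [map_sum, map_add, LinearMap.sum_apply, LinearMap.add_apply,
    LinearMap.map_smul_of_tower, LinearMap.smul_apply, hV1, Complex.add_re, Complex.one_re,
    Complex.re_sum, Complex.smul_re, smul_eq_mul] at b1 b2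
  have p1 : ∀ k, 0 ≤ (V (D k) 1).re := fun k => hV.re_nonneg (hD k).1
  have p2 : ∀ k, 0 ≤ (V 1 (E k)).re := fun k => hV.flip.re_nonneg (hE k).1
  have e : V x y = ∑ k ∈ Finset.range N, ∑ l ∈ Finset.range M, V (D k) (E l) := by
    rw [← hDx, ← hEy]; simp only [map_sum, LinearMap.sum_apply]
    rw [Finset.sum_comm]
  rw [e]
  calc ‖∑ k ∈ Finset.range N, ∑ l ∈ Finset.range M, V (D k) (E l)‖
      ≤ ∑ k ∈ Finset.range N, ∑ l ∈ Finset.range M,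
        (4 * (4 ^ k * (V (D k) 1).re * ((2 : ℝ) ^ l)⁻¹) +
          4 * (4 ^ l * (V 1 (E l)).re * ((2 : ℝ) ^ k)⁻¹)) := by
        refine (norm_sum_le _ _).trans (Finset.sum_le_sum fun k _ => (norm_sum_le _ _).trans
          (Finset.sum_le_sum fun l _ => ?_))
        refine (hV.norm_le_of_le_smul_one (by positivity) (by positivity) (hD k).1 (hD k).2
          (hE l).1 (hE l).2).trans_eq ?_
        rw [← pow_mul, ← pow_mul, mul_comm k 2, mul_comm l 2, pow_mul, pow_mul]
        norm_num
        ring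
    _ = 4 * ((∑ k ∈ Finset.range N, 4 ^ k * (V (D k) 1).re) *
          ∑ l ∈ Finset.range M, ((2 : ℝ) ^ l)⁻¹) +
        4 * ((∑ l ∈ Finset.range M, 4 ^ l * (V 1 (E l)).re) *
          ∑ k ∈ Finset.range N, ((2 : ℝ) ^ k)⁻¹) := by
        simp only [Finset.sum_add_distrib, ← Finset.mul_sum, ← Finset.sum_mul]
    _ ≤ 4 * ((1 + 8 * (V (x ^ 4) 1).re) * 2) + 4 * ((1 + 8 * (V 1 (y ^ 4)).re) * 2) := by
        have s1 : 0 ≤ ∑ k ∈ Finset.range N, 4 ^ k * (V (D k) 1).re :=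
          Finset.sum_nonneg fun k _ => mul_nonneg (by positivity) (p1 k)
        have s2 : 0 ≤ ∑ k ∈ Finset.range M, 4 ^ k * (V 1 (E k)).re :=
          Finset.sum_nonneg fun k _ => mul_nonneg (by positivity) (p2 k)
        gcongr
        · exact s1.trans b1
        · exact geom M
        · exact s2.trans b2
        · exact geom N
    _ = _ := by ring

theorem norm_le_of_isSelfAdjoint (hV : IsNormalizedForm V) {x : A} (hx : IsSelfAdjoint x) {y : B}
    (hy : IsSelfAdjoint y) :
    ‖V x y‖ ≤ 32 * ((1 + 8 * (V (x ^ 4) 1).re) + (1 + 8 * (V 1 (y ^ 4)).re)) := by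
  obtain ⟨x₁, x₂, hx₁, hx₂, rfl, lx₁, lx₂⟩ := exists_sub_nonneg_pow_four_le hx
  obtain ⟨y₁, y₂, hy₁, hy₂, rfl, ly₁, ly₂⟩ := exists_sub_nonneg_pow_four_le hy
  have e : V (x₁ - x₂) (y₁ - y₂) = V x₁ y₁ - V x₂ y₁ - (V x₁ y₂ - V x₂ y₂) := by
    simp only [map_sub, LinearMap.sub_apply]
  rw [e]
  have n := norm_sub_le (V x₁ y₁ - V x₂ y₁) (V x₁ y₂ - V x₂ y₂)
  have n1 := norm_sub_le (V x₁ y₁) (V x₂ y₁)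
  have n2 := norm_sub_le (V x₁ y₂) (V x₂ y₂)
  have a1 := hV.norm_le_of_nonneg hx₁ hy₁
  have a2 := hV.norm_le_of_nonneg hx₂ hy₁
  have a3 := hV.norm_le_of_nonneg hx₁ hy₂
  have a4 := hV.norm_le_of_nonneg hx₂ hy₂
  have m1 := hV.re_mono lx₁
  have m2 := hV.re_mono lx₂
  have m3 := hV.flip.re_mono ly₁
  have m4 := hV.flip.re_mono ly₂
  simp only [LinearMap.flip_apply] at m3 m4
  linarith

end IsNormalizedForm

/-- All signed sums of a list. -/
def signSums {G : Type*} [AddCommGroup G] : List G → List G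
  | [] => [0]
  | p :: l => (signSums l).map (fun X => X + p) ++ (signSums l).map (fun X => X - p)

theorem length_signSums {G : Type*} [AddCommGroup G] (l : List G) :
    (signSums l).length = 2 ^ l.length := by
  induction l with
  | nil => rfl
  | cons p l ih => simp [signSums, ih, pow_succ]; ring

theorem map_signSums {G H : Type*} [AddCommGroup G] [AddCommGroup H] (f : G →+ H) (l : List G) :
    (signSums l).map f = signSums (l.map f) := by
  induction l with
  | nil => simp [signSums]
  | cons p l ih => simp [signSums, ← ih, Function.comp_def]

theorem sum_map_signSums_cons {G H : Type*} [AddCommGroup G] [AddCommMonoid H] (f : G → H)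
    (p : G) (l : List G) : ((signSums (p :: l)).map f).sum =
      ((signSums l).map fun X => f (X + p) + f (X - p)).sum := by
  rw [signSums, List.map_append, List.sum_append, List.map_map, List.map_map, List.sum_map_add]
  rfl

/-- Orthogonality of the signs: only the diagonal of a biadditive map survives. -/
theorem sum_map_signSums_biadditive {G H : Type*} [AddCommGroup G] [AddCommGroup H]
    (f : G →+ G →+ H) (l : List G) : ((signSums l).map fun X => f X X).sum =
      2 ^ l.length • (l.map fun p => f p p).sum := by
  induction l with
  | nil => simp [signSums]
  | cons p l ih =>
    rw [sum_map_signSums_cons]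
    have : (fun X => f (X + p) (X + p) + f (X - p) (X - p)) =
        fun X => (2 • f X X) + 2 • f p p := by
      ext X; simp only [map_add, map_sub, AddMonoidHom.add_apply, AddMonoidHom.sub_apply]; abel
    simp only [this, two_nsmul, List.sum_map_add, List.map_const', List.sum_replicate,
      length_signSums, ih, List.map_cons, List.sum_cons, List.length_cons, pow_succ, mul_two,
      add_nsmul, nsmul_add]
    abel

theorem sum_map_signSums_mul_mul {R : Type*} [Ring R] (z : R) (l : List R) :
    ((signSums l).map fun X => X * z * X).sum = 2 ^ l.length • (l.map fun p => p * z * p).sum :=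
  sum_map_signSums_biadditive ((AddMonoidHom.mul : R →+ R →+ R).comp (AddMonoidHom.mulRight z)) l

theorem sum_map_signSums_mul {R : Type*} [Ring R] (l : List R) :
    ((signSums l).map fun X => X * X).sum = 2 ^ l.length • (l.map fun p => p * p).sum :=
  sum_map_signSums_biadditive (AddMonoidHom.mul : R →+ R →+ R) l

theorem isSelfAdjoint_of_mem_signSums {R : Type*} [Ring R] [StarRing R] {l : List R}
    (hl : ∀ x ∈ l, IsSelfAdjoint x) : ∀ X ∈ signSums l, IsSelfAdjoint X := by
  induction l with
  | nil => simp [signSums]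
  | cons p l ih =>
    have hp := hl p (by simp)
    have ih := ih fun x hx => hl x (by simp [hx])
    intro X hX
    simp only [signSums, List.mem_append, List.mem_map] at hX
    rcases hX with ⟨Y, hY, rfl⟩ | ⟨Y, hY, rfl⟩
    · exact (ih Y hY).add hp
    · exact (ih Y hY).sub hp

theorem add_pow_four_add_sub_pow_four_le {x y : A} (hx : IsSelfAdjoint x) (hy : IsSelfAdjoint y) :
    (x + y) ^ 4 + (x - y) ^ 4 ≤ 2 • (x ^ 4 + x * x * (y * y) + y * y * (x * x) + y ^ 4 +
      2 • (y * (x * x) * y + x * (y * y) * x)) := by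
  rw [← sub_nonneg]
  have h := star_mul_self_nonneg (y * x - x * y)
  have e : star (y * x - x * y) = x * y - y * x := by
    rw [star_sub, star_mul, star_mul, hx.star_eq, hy.star_eq]
  rw [e] at h
  convert nsmul_nonneg h 2 using 1
  noncomm_ring

theorem sum_map_signSums_pow_four_le {l : List A} (hl : ∀ x ∈ l, IsSelfAdjoint x) :
    ((signSums l).map fun X => X ^ 4).sum ≤ 2 ^ l.length •
      ((l.map fun x => x * x).sum * (l.map fun x => x * x).sum +
        2 • (l.map fun x => x * (l.map fun y => y * y).sum * x).sum) := by
  induction l with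
  | nil => simp [signSums]
  | cons p l ih =>
    have hp := hl p (by simp)
    have hl' : ∀ x ∈ l, IsSelfAdjoint x := fun x hx => hl x (by simp [hx])
    have ih := ih hl'
    have hS := isSelfAdjoint_of_mem_signSums hl'
    rw [sum_map_signSums_cons]
    refine (List.sum_le_sum fun X hX => add_pow_four_add_sub_pow_four_le (hS X hX) hp).trans ?_
    simp only [two_nsmul, List.sum_map_add, List.sum_map_mul_right, List.sum_map_mul_left,
      sum_map_signSums_mul_mul, sum_map_signSums_mul, List.map_const', List.sum_replicate,
      length_signSums, List.map_cons, List.sum_cons, List.length_cons, pow_succ, mul_two,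
      mul_add, add_mul, add_nsmul, nsmul_add, mul_smul_comm, smul_mul_assoc] at ih ⊢
    generalize (List.map (fun x => x * x) l).sum = s at *
    generalize (List.map (fun x => x * s * x) l).sum = q at *
    rw [← sub_nonneg] at ih ⊢
    have h4 : 0 ≤ p ^ 4 := (hp.pow 2).sq_nonneg.trans_eq (by rw [← pow_mul])
    have e := add_nonneg (nsmul_nonneg ih 2) (nsmul_nonneg (nsmul_nonneg h4 (2 ^ l.length)) 4)
    convert e using 1
    noncomm_ring

theorem list_sum_pow_four_aux {l : List A} (hl : ∀ x ∈ l, IsSelfAdjoint x)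
    (h1 : (l.map fun x => x * x).sum ≤ 1) :
    ((signSums l).map fun X => X ^ 4).sum ≤ 2 ^ l.length • (3 : A) := by
  refine (sum_map_signSums_pow_four_le hl).trans (nsmul_le_nsmul_right ?_ _)
  have hs : 0 ≤ (l.map fun x => x * x).sum := List.sum_nonneg fun y hy => by
    obtain ⟨x, hx, rfl⟩ := List.mem_map.1 hy
    simpa [(hl x hx).star_eq] using star_mul_self_nonneg x
  have a1 : (l.map fun x => x * x).sum * (l.map fun x => x * x).sum ≤ 1 := by
    refine le_trans ?_ h1
    simpa [sq] using CStarAlgebra.pow_antitone hs h1 (show 1 ≤ 2 by norm_num)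
  have a2 : (l.map fun x => x * (l.map fun y => y * y).sum * x).sum ≤ 1 := by
    refine le_trans (List.sum_le_sum fun x hx => ?_) h1
    simpa [(hl x hx).star_eq] using star_left_conjugate_le_conjugate h1 x
  calc _ ≤ (1 : A) + 2 • 1 := add_le_add a1 (nsmul_le_nsmul_right a2 2)
    _ = 3 := by norm_num

namespace IsNormalizedForm

variable {V : A →ₗ[ℂ] B →ₗ[ℂ] ℂ}

theorem re_list_sum_map {A B : Type*} [CStarAlgebra A] [CStarAlgebra B] {V : A →ₗ[ℂ] B →ₗ[ℂ] ℂ}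
    {ι : Type*} (f : ι → A) (b : B) (l : List ι) :
    (V (l.map f).sum b).re = (l.map fun i => (V (f i) b).re).sum := by
  induction l with
  | nil => simp
  | cons p l ih => simp [ih]

/-- The Grothendieck-type inequality for families of self-adjoint elements. -/
theorem norm_list_sum_le (hV : IsNormalizedForm V) {l : List (A × B)}
    (h₁ : ∀ p ∈ l, IsSelfAdjoint p.1) (h₂ : ∀ p ∈ l, IsSelfAdjoint p.2)
    (s₁ : (l.map fun p => p.1 * p.1).sum ≤ 1) (s₂ : (l.map fun p => p.2 * p.2).sum ≤ 1) :
    ‖(l.map fun p => V p.1 p.2).sum‖ ≤ 1600 := by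
  have g₁ : ∀ x ∈ l.map Prod.fst, IsSelfAdjoint x := by simpa using fun a b h => h₁ (a, b) h
  have g₂ : ∀ x ∈ l.map Prod.snd, IsSelfAdjoint x := by simpa using fun a b h => h₂ (b, a) h
  have q₁ := list_sum_pow_four_aux g₁ (by simpa [Function.comp_def] using s₁)
  have q₂ := list_sum_pow_four_aux g₂ (by simpa [Function.comp_def] using s₂)
  have m₁ : (signSums l).map Prod.fst = signSums (l.map Prod.fst) :=
    map_signSums (AddMonoidHom.fst A B) l
  have m₂ : (signSums l).map Prod.snd = signSums (l.map Prod.snd) :=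
    map_signSums (AddMonoidHom.snd A B) l
  have t₁ := isSelfAdjoint_of_mem_signSums g₁
  have t₂ := isSelfAdjoint_of_mem_signSums g₂
  rw [← m₁] at q₁ t₁
  rw [← m₂] at q₂ t₂
  have r₁ := hV.re_mono q₁
  have r₂ := hV.flip.re_mono q₂
  rw [re_list_sum_map, List.map_map] at r₁ r₂
  have v3 : V 3 1 = 3 := by
    have : (3 : A) = (3 : ℕ) • 1 := by simp
    rw [this, map_nsmul, LinearMap.smul_apply, hV.map_one]; simp
  have v3' : V 1 3 = 3 := by
    have : (3 : B) = (3 : ℕ) • 1 := by simp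
    rw [this, map_nsmul, hV.map_one]; simp
  let f : A × B →+ A × B →+ ℂ := AddMonoidHom.mk'
    (fun p => (V p.1).toAddMonoidHom.comp (AddMonoidHom.snd A B)) fun p q => by ext; simp
  have key : ((signSums l).map fun X => V X.1 X.2).sum =
    2 ^ l.length • (l.map fun p => V p.1 p.2).sum := sum_map_signSums_biadditive f l
  have nb : ‖((signSums l).map fun X => V X.1 X.2).sum‖ ≤ ((signSums l).map fun X : A × B =>
      32 * ((1 + 8 * (V (X.1 ^ 4) 1).re) + (1 + 8 * (V 1 (X.2 ^ 4)).re))).sum := by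
    refine (List.le_sum_of_subadditive norm norm_zero.le norm_add_le _).trans ?_
    rw [List.map_map]
    exact List.sum_le_sum fun X hX => hV.norm_le_of_isSelfAdjoint
      (t₁ _ (List.mem_map_of_mem hX)) (t₂ _ (List.mem_map_of_mem hX))
  rw [key, nsmul_eq_mul, norm_mul] at nb
  simp only [List.sum_map_mul_left, List.sum_map_add, List.map_const', List.sum_replicate,
    length_signSums] at nb
  rw [map_nsmul, LinearMap.smul_apply, v3] at r₁
  rw [map_nsmul, LinearMap.smul_apply, LinearMap.flip_apply, v3'] at r₂
  simp only [Function.comp_def, nsmul_eq_mul, List.length_map, LinearMap.flip_apply] at r₁ r₂ nb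
  have hp : (0 : ℝ) < 2 ^ l.length := by positivity
  have hre : ((2 : ℂ) ^ l.length).re = 2 ^ l.length := by
    have := Complex.ofReal_re (2 ^ l.length)
    simpa using this
  simp [hre] at r₁ r₂ nb
  refine le_of_mul_le_mul_left ?_ hp
  linarith

end IsNormalizedForm

end FourthPowers

section RowColumn


theorem norm_sum_map_le_one_of_row_column {A : Type*} [CStarAlgebra A] [PartialOrder A]
    [StarOrderedRing A] {ι : Type*} {f : ι → A} {l : List ι}
    (h₁ : ‖(l.map fun i => star (f i) * f i).sum‖ ≤ 1)
    (h₂ : ‖(l.map fun i => f i * star (f i)).sum‖ ≤ 1) :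
    (l.map fun i => (ℜ (f i) * ℜ (f i) : A)).sum ≤ 1 ∧
      (l.map fun i => (ℑ (f i) * ℑ (f i) : A)).sum ≤ 1 := by
  have n₁ : 0 ≤ (l.map fun i => star (f i) * f i).sum := List.sum_nonneg fun y hy => by
    obtain ⟨x, hx, rfl⟩ := List.mem_map.1 hy
    exact star_mul_self_nonneg _
  have n₂ : 0 ≤ (l.map fun i => f i * star (f i)).sum := List.sum_nonneg fun y hy => by
    obtain ⟨x, hx, rfl⟩ := List.mem_map.1 hy
    exact mul_star_self_nonneg _
  have r : 0 ≤ (l.map fun i => (ℜ (f i) * ℜ (f i) : A)).sum := List.sum_nonneg fun y hy => by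
    obtain ⟨x, hx, rfl⟩ := List.mem_map.1 hy
    simpa using star_mul_self_nonneg (ℜ (f x) : A)
  have s : 0 ≤ (l.map fun i => (ℑ (f i) * ℑ (f i) : A)).sum := List.sum_nonneg fun y hy => by
    obtain ⟨x, hx, rfl⟩ := List.mem_map.1 hy
    simpa using star_mul_self_nonneg (ℑ (f x) : A)
  have k₁ := (CStarAlgebra.norm_le_one_iff_of_nonneg _ n₁).1 h₁
  have k₂ := (CStarAlgebra.norm_le_one_iff_of_nonneg _ n₂).1 h₂
  have e : (2 : ℝ) • ((l.map fun i => (ℜ (f i) * ℜ (f i) : A)).sum +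
      (l.map fun i => (ℑ (f i) * ℑ (f i) : A)).sum) =
      (l.map fun i => star (f i) * f i).sum + (l.map fun i => f i * star (f i)).sum := by
    rw [← List.sum_map_add, ← List.sum_map_add]
    simp only [star_mul_self_add_self_mul_star, List.sum_map_add, two_smul]
  have k : (l.map fun i => (ℜ (f i) * ℜ (f i) : A)).sum +
      (l.map fun i => (ℑ (f i) * ℑ (f i) : A)).sum ≤ 1 := by
    have : (2 : ℝ) • ((l.map fun i => (ℜ (f i) * ℜ (f i) : A)).sum +
      (l.map fun i => (ℑ (f i) * ℑ (f i) : A)).sum) ≤ (2 : ℝ) • (1 : A) := by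
      rw [e, two_smul]; exact add_le_add k₁ k₂
    exact le_of_smul_le_smul_left this (by norm_num)
  exact ⟨(le_add_of_nonneg_right s).trans k, (le_add_of_nonneg_left r).trans k⟩

theorem IsNormalizedForm.norm_list_sum_le_of_row_column {A B : Type*} [CStarAlgebra A]
    [CStarAlgebra B] {V : A →ₗ[ℂ] B →ₗ[ℂ] ℂ} (hV : IsNormalizedForm V)
    {ι : Type*} {f : ι → A} {g : ι → B} {l : List ι}
    (h₁ : ‖(l.map fun i => star (f i) * f i).sum‖ ≤ 1)
    (h₂ : ‖(l.map fun i => f i * star (f i)).sum‖ ≤ 1)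
    (h₃ : ‖(l.map fun i => star (g i) * g i).sum‖ ≤ 1)
    (h₄ : ‖(l.map fun i => g i * star (g i)).sum‖ ≤ 1) :
    ‖(l.map fun i => V (f i) (g i)).sum‖ ≤ 6400 := by
  let _ := CStarAlgebra.spectralOrder A
  let _ := CStarAlgebra.spectralOrder B
  have := CStarAlgebra.spectralOrderedRing A
  have := CStarAlgebra.spectralOrderedRing B
  obtain ⟨a₁, a₂⟩ := norm_sum_map_le_one_of_row_column h₁ h₂
  obtain ⟨b₁, b₂⟩ := norm_sum_map_le_one_of_row_column h₃ h₄
  have key : ∀ (p : ι → selfAdjoint A) (q : ι → selfAdjoint B),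
      (l.map fun i => (p i * p i : A)).sum ≤ 1 → (l.map fun i => (q i * q i : B)).sum ≤ 1 →
      ‖(l.map fun i => V (p i) (q i)).sum‖ ≤ 1600 := by
    intro p q hp hq
    have := hV.norm_list_sum_le (l := l.map fun i => ((p i : A), (q i : B)))
      (by simp) (by simp) (by simpa [Function.comp_def] using hp)
      (by simpa [Function.comp_def] using hq)
    simpa [Function.comp_def] using this
  have e : ∀ i, V (f i) (g i) = (V (ℜ (f i)) (ℜ (g i)) + -1 * V (ℑ (f i)) (ℑ (g i))) +
      Complex.I * (V (ℜ (f i)) (ℑ (g i)) + V (ℑ (f i)) (ℜ (g i))) := by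
    intro i
    conv_lhs => rw [← realPart_add_I_smul_imaginaryPart (f i),
      ← realPart_add_I_smul_imaginaryPart (g i)]
    simp only [map_add, map_smul, LinearMap.add_apply, LinearMap.smul_apply, smul_eq_mul]
    linear_combination (V (ℑ (f i)) (ℑ (g i))) * Complex.I_sq
  simp only [e, List.sum_map_add, List.sum_map_mul_left]
  simp only [neg_one_mul]
  refine (norm_add_le _ _).trans ?_
  rw [norm_mul, Complex.norm_I, one_mul]
  have n1 := norm_add_le ((l.map fun i => V (ℜ (f i)) (ℜ (g i))).sum)
    (-(l.map fun i => V (ℑ (f i)) (ℑ (g i))).sum)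
  have n2 := norm_add_le ((l.map fun i => V (ℜ (f i)) (ℑ (g i))).sum)
    ((l.map fun i => V (ℑ (f i)) (ℜ (g i))).sum)
  rw [norm_neg] at n1
  linarith [key _ _ a₁ b₁, key _ _ a₂ b₂, key _ _ a₁ b₂, key _ _ a₂ b₁]

theorem norm_le_one_of_mem_unitary {A : Type*} [CStarAlgebra A] {u : A} (hu : u ∈ unitary A) :
    ‖u‖ ≤ 1 := by
  rcases subsingleton_or_nontrivial A with h | h
  · simp [Subsingleton.elim u 0]
  · exact (CStarRing.norm_of_mem_unitary hu).le

open scoped BoundedContinuousFunction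

theorem norm_list_sum_le_of_apply {A ι : Type*} [NormedAddCommGroup A] {f : ι → ℕ →ᵇ A}
    {l : List ι} (h : ∀ n, ‖(l.map fun i => f i n).sum‖ ≤ 1) : ‖(l.map f).sum‖ ≤ 1 := by
  have e : ∀ n, (l.map f).sum n = (l.map fun i => f i n).sum := by
    intro n
    clear h
    induction l with
    | nil => rfl
    | cons p l ih => simp [ih]
  exact (BoundedContinuousFunction.norm_le zero_le_one).2 fun n => by rw [e]; exact h n

open Filter Topology in
/-- Bounded bilinear forms on C*-algebras satisfy a row-column inequality. The proof passes to
an ultralimit of translates, for which the supremum over unitaries is attained. -/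
theorem exists_row_column_bound {A B : Type*} [CStarAlgebra A] [CStarAlgebra B]
    (V : A →ₗ[ℂ] B →ₗ[ℂ] ℂ) (M : ℝ) (hM : ∀ a b, ‖V a b‖ ≤ M * ‖a‖ * ‖b‖) :
    ∃ K : ℝ, 0 ≤ K ∧ ∀ l : List (A × B),
      ‖(l.map fun p => star p.1 * p.1).sum‖ ≤ 1 → ‖(l.map fun p => p.1 * star p.1).sum‖ ≤ 1 →
      ‖(l.map fun p => star p.2 * p.2).sum‖ ≤ 1 → ‖(l.map fun p => p.2 * star p.2).sum‖ ≤ 1 →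
      ‖(l.map fun p => V p.1 p.2).sum‖ ≤ K := by
  set S : Set ℝ := {r | ∃ u ∈ unitary A, ∃ v ∈ unitary B, r = ‖V u v‖} with hS
  have hM0 : ∀ a b, ‖V a b‖ ≤ |M| * ‖a‖ * ‖b‖ := fun a b => (hM a b).trans (by
    gcongr; exact le_abs_self M)
  have hbdd : BddAbove S := by
    refine ⟨|M|, ?_⟩
    rintro _ ⟨u, hu, v, hv, rfl⟩
    refine (hM0 u v).trans ?_
    rw [mul_assoc]
    exact mul_le_of_le_one_right (abs_nonneg M) (mul_le_one₀ (norm_le_one_of_mem_unitary hu)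
      (norm_nonneg _) (norm_le_one_of_mem_unitary hv))
  have hne : S.Nonempty := ⟨_, 1, one_mem _, 1, one_mem _, rfl⟩
  set m := sSup S with hm
  have hle : ∀ u ∈ unitary A, ∀ v ∈ unitary B, ‖V u v‖ ≤ m := fun u hu v hv =>
    le_csSup hbdd ⟨u, hu, v, hv, rfl⟩
  have hm0 : 0 ≤ m := (norm_nonneg _).trans (hle 1 (one_mem _) 1 (one_mem _))
  refine ⟨6400 * m, by positivity, fun l h₁ h₂ h₃ h₄ => ?_⟩
  rcases hm0.eq_or_lt with h0 | hpos
  · have hz : V = 0 := by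
      refine LinearMap.ext_on_range (v := fun u : unitary A => (u : A)) ?_ fun u => ?_
      · exact (congrArg (Submodule.span ℂ) Subtype.range_coe).trans (CStarAlgebra.span_unitary A)
      · refine LinearMap.ext_on_range (v := fun u : unitary B => (u : B)) ?_ fun v => ?_
        · exact (congrArg (Submodule.span ℂ) Subtype.range_coe).trans (CStarAlgebra.span_unitary B)
        · have := hle u u.2 v v.2
          rw [← h0] at this
          simpa using this
    simp [hz, hm0]
  have hex : ∀ n : ℕ, ∃ u ∈ unitary A, ∃ v ∈ unitary B, m - 1 / ((n : ℝ) + 1) < ‖V u v‖ := by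
    intro n
    obtain ⟨_, ⟨u, hu, v, hv, rfl⟩, h⟩ := exists_lt_of_lt_csSup hne
      (show m - 1 / ((n : ℝ) + 1) < m from sub_lt_self _ (by positivity))
    exact ⟨u, hu, v, hv, h⟩
  choose u hu v hv huv using hex
  have hph : ∀ n, ∃ θ : ℂ, ‖θ‖ = 1 ∧ θ * V (u n) (v n) = ‖V (u n) (v n)‖ := by
    intro n
    rcases eq_or_ne (V (u n) (v n)) 0 with h | h
    · exact ⟨1, by simp, by simp [h]⟩
    · refine ⟨‖V (u n) (v n)‖ / V (u n) (v n), ?_, div_mul_cancel₀ _ h⟩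
      rw [norm_div, Complex.norm_real, norm_norm, div_self (norm_ne_zero_iff.2 h)]
  choose θ hθ1 hθ using hph
  let W : ℕ → (ℕ →ᵇ A) → (ℕ →ᵇ B) → ℂ := fun n F G =>
    (m : ℂ)⁻¹ * (θ n * V (u n * F n) (v n * G n))
  have nW : ∀ n F G, ‖W n F G‖ = m⁻¹ * ‖V (u n * F n) (v n * G n)‖ := by
    intro n F G
    simp only [W, norm_mul, hθ1, one_mul, norm_inv, Complex.norm_real, Real.norm_of_nonneg hm0]
  let U : Ultrafilter ℕ := hyperfilter ℕ
  have hU : (U : Filter ℕ) ≤ atTop := Nat.hyperfilter_le_atTop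
  have hlim : ∀ F G, ∃ z, Tendsto (fun n => W n F G) U (𝓝 z) := by
    intro F G
    have hb : ∀ n, W n F G ∈ Metric.closedBall (0 : ℂ) (m⁻¹ * (|M| * ‖F‖ * ‖G‖)) := by
      intro n
      rw [mem_closedBall_zero_iff, nW]
      gcongr
      refine (hM0 _ _).trans ?_
      have e1 : ‖u n * F n‖ ≤ ‖F‖ := by
        rw [CStarRing.norm_mem_unitary_mul _ (hu n)]; exact F.norm_coe_le_norm n
      have e2 : ‖v n * G n‖ ≤ ‖G‖ := by
        rw [CStarRing.norm_mem_unitary_mul _ (hv n)]; exact G.norm_coe_le_norm n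
      gcongr
    obtain ⟨z, -, hz⟩ := (isCompact_closedBall (0 : ℂ) (m⁻¹ * (|M| * ‖F‖ * ‖G‖))).ultrafilter_le_nhds
      (U.map fun n => W n F G) (by
        rw [le_principal_iff]; exact Filter.mem_map.2 (Filter.univ_mem' hb))
    exact ⟨z, hz⟩
  choose L hL using hlim
  have uniq : ∀ {f : ℕ → ℂ} {z w : ℂ}, Tendsto f U (𝓝 z) → Tendsto f U (𝓝 w) → z = w :=
    fun h h' => tendsto_nhds_unique h h'
  let Vω : (ℕ →ᵇ A) →ₗ[ℂ] (ℕ →ᵇ B) →ₗ[ℂ] ℂ := LinearMap.mk₂ ℂ L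
    (fun F F' G => uniq (hL _ _) (((hL F G).add (hL F' G)).congr fun n => by
      simp only [W, BoundedContinuousFunction.coe_add, Pi.add_apply, mul_add, map_add,
        LinearMap.add_apply]))
    (fun c F G => uniq (hL _ _) (((hL F G).const_mul c).congr fun n => by
      simp only [W, BoundedContinuousFunction.coe_smul, mul_smul_comm, map_smul,
        LinearMap.smul_apply, smul_eq_mul]; ring))
    (fun F G G' => uniq (hL _ _) (((hL F G).add (hL F G')).congr fun n => by
      simp only [W, BoundedContinuousFunction.coe_add, Pi.add_apply, mul_add, map_add]))
    (fun c F G => uniq (hL _ _) (((hL F G).const_mul c).congr fun n => by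
      simp only [W, BoundedContinuousFunction.coe_smul, mul_smul_comm, map_smul,
        smul_eq_mul]; ring))
  have hVω : ∀ F G, Vω F G = L F G := fun _ _ => rfl
  have hnorm : IsNormalizedForm Vω := by
    constructor
    · intro F hF G hG
      rw [hVω]
      refine le_of_tendsto (hL F G).norm (Eventually.of_forall fun n => ?_)
      have hFn : F n ∈ unitary A :=
        ⟨DFunLike.congr_fun hF.1 n, DFunLike.congr_fun hF.2 n⟩
      have hGn : G n ∈ unitary B :=
        ⟨DFunLike.congr_fun hG.1 n, DFunLike.congr_fun hG.2 n⟩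
      rw [nW, inv_mul_le_iff₀ hpos, mul_one]
      exact hle _ (mul_mem (hu n) hFn) _ (mul_mem (hv n) hGn)
    · rw [hVω]
      refine uniq (hL 1 1) ?_
      have h1 : ∀ n, W n 1 1 = ((m⁻¹ * ‖V (u n) (v n)‖ : ℝ) : ℂ) := by
        intro n; simp [W, hθ]
      simp only [h1]
      have h2 : Tendsto (fun n => ‖V (u n) (v n)‖) atTop (𝓝 m) := by
        refine tendsto_of_tendsto_of_tendsto_of_le_of_le (g := fun n : ℕ => m - 1 / ((n : ℝ) + 1))
          (h := fun _ => m) ?_ tendsto_const_nhds (fun n => (huv n).le)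
          (fun n => hle _ (hu n) _ (hv n))
        simpa using (tendsto_one_div_add_atTop_nhds_zero_nat (𝕜 := ℝ)).const_sub m
      have h3 := (h2.const_mul m⁻¹).mono_left hU
      rw [inv_mul_cancel₀ hpos.ne'] at h3
      exact (Complex.continuous_ofReal.tendsto _).comp h3
  have bA : ∀ (n : ℕ) (a : A), ‖star (u n) * a‖ ≤ ‖a‖ := fun n a => by
    rw [CStarRing.norm_mem_unitary_mul _ (Unitary.star_mem (hu n))]
  have bB : ∀ (n : ℕ) (a : B), ‖star (v n) * a‖ ≤ ‖a‖ := fun n a => by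
    rw [CStarRing.norm_mem_unitary_mul _ (Unitary.star_mem (hv n))]
  let f : A × B → ℕ →ᵇ A := fun p =>
    BoundedContinuousFunction.ofNormedAddCommGroupDiscrete (fun n => star (u n) * p.1) ‖p.1‖
      fun n => bA n _
  let g : A × B → ℕ →ᵇ B := fun p =>
    BoundedContinuousFunction.ofNormedAddCommGroupDiscrete (fun n => star (v n) * p.2) ‖p.2‖
      fun n => bB n _
  have eV : ∀ n p, V (u n * f p n) (v n * g p n) = V p.1 p.2 := by
    intro n p
    change V (u n * (star (u n) * p.1)) (v n * (star (v n) * p.2)) = V p.1 p.2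
    rw [← mul_assoc, ← mul_assoc, (hu n).2, (hv n).2, one_mul, one_mul]
  have key := hnorm.norm_list_sum_le_of_row_column (f := f) (g := g) (l := l) ?_ ?_ ?_ ?_
  · have t : Tendsto (fun n => (l.map fun p => W n (f p) (g p)).sum) U
        (𝓝 (l.map fun p => Vω (f p) (g p)).sum) :=
      tendsto_list_sum l fun p _ => hL (f p) (g p)
    have e : ∀ n, ‖(l.map fun p => W n (f p) (g p)).sum‖ =
        m⁻¹ * ‖(l.map fun p => V p.1 p.2).sum‖ := by
      intro n
      simp only [W, eV, List.sum_map_mul_left, norm_mul, hθ1, one_mul, norm_inv,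
        Complex.norm_real, Real.norm_of_nonneg hm0]
    have t' := t.norm
    simp only [e] at t'
    rw [tendsto_nhds_unique t' tendsto_const_nhds, inv_mul_le_iff₀ hpos] at key
    linarith
  · refine norm_list_sum_le_of_apply (fun n => ?_)
    refine le_of_eq_of_le (congrArg norm (congrArg List.sum ?_)) h₁
    refine List.map_congr_left fun p _ => ?_
    change star (star (u n) * p.1) * (star (u n) * p.1) = _
    rw [star_mul, star_star, mul_assoc, ← mul_assoc (u n), (hu n).2, one_mul]
  · refine norm_list_sum_le_of_apply (fun n => ?_)
    have e : ∀ p, (f p * star (f p)) n = star (u n) * (p.1 * star p.1) * u n := by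
      intro p
      change (star (u n) * p.1) * star (star (u n) * p.1) = _
      rw [star_mul, star_star]; simp only [mul_assoc]
    simp only [e, List.sum_map_mul_right, List.sum_map_mul_left]
    rwa [CStarRing.norm_mul_mem_unitary _ (hu n),
      CStarRing.norm_mem_unitary_mul _ (Unitary.star_mem (hu n))]
  · refine norm_list_sum_le_of_apply (fun n => ?_)
    refine le_of_eq_of_le (congrArg norm (congrArg List.sum ?_)) h₃
    refine List.map_congr_left fun p _ => ?_
    change star (star (v n) * p.2) * (star (v n) * p.2) = _
    rw [star_mul, star_star, mul_assoc, ← mul_assoc (v n), (hv n).2, one_mul]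
  · refine norm_list_sum_le_of_apply (fun n => ?_)
    have e : ∀ p, (g p * star (g p)) n = star (v n) * (p.2 * star p.2) * v n := by
      intro p
      change (star (v n) * p.2) * star (star (v n) * p.2) = _
      rw [star_mul, star_star]; simp only [mul_assoc]
    simp only [e, List.sum_map_mul_right, List.sum_map_mul_left]
    rwa [CStarRing.norm_mul_mem_unitary _ (hv n),
      CStarRing.norm_mem_unitary_mul _ (Unitary.star_mem (hv n))]

end RowColumn

section ContractionKernel

theorem Matrix.sum_star_sum_smul_mul_sum_smul {k n A : Type*} [Fintype k] [Fintype n]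
    [NonUnitalCStarAlgebra A] (D : Matrix k n ℂ) (a : n → A) :
    ∑ i, star (∑ j, D i j • a j) * ∑ j, D i j • a j =
      ∑ j, ∑ l, (D.conjTranspose * D) j l • (star (a j) * a l) := by
  simp only [star_sum, Finset.sum_mul, Finset.mul_sum, star_smul, smul_mul_smul_comm,
    Matrix.mul_apply, Matrix.conjTranspose_apply, Finset.sum_smul]
  rw [Finset.sum_comm]
  conv_rhs => rw [Finset.sum_comm]
  refine Finset.sum_congr rfl fun j _ => ?_
  rw [Finset.sum_comm]

open scoped MatrixOrder ComplexOrder in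
theorem Matrix.sum_star_mulVec_mul_mulVec_le {m n A : Type*} [Fintype m] [Fintype n]
    [NonUnitalCStarAlgebra A] [PartialOrder A] [StarOrderedRing A] (C : Matrix m n ℂ)
    (hC : ∀ ξ : n → ℂ, ∑ i, ‖∑ j, C i j * ξ j‖ ^ 2 ≤ ∑ j, ‖ξ j‖ ^ 2) (a : n → A) :
    ∑ i, star (∑ j, C i j • a j) * ∑ j, C i j • a j ≤ ∑ j, star (a j) * a j := by
  classical
  have hpsd : (1 - C.conjTranspose * C).PosSemidef := by
    refine Matrix.PosSemidef.of_dotProduct_mulVec_nonneg ?_ fun ξ => ?_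
    · exact Matrix.isHermitian_one.sub (Matrix.isHermitian_conjTranspose_mul_self C)
    · have e₁ : star ξ ⬝ᵥ ξ = ((∑ i, ‖ξ i‖ ^ 2 : ℝ) : ℂ) := by
        simp [dotProduct, Complex.conj_mul']
      have e₂ : star (C.mulVec ξ) ⬝ᵥ C.mulVec ξ = ((∑ i, ‖C.mulVec ξ i‖ ^ 2 : ℝ) : ℂ) := by
        simp [dotProduct, Complex.conj_mul']
      rw [Matrix.sub_mulVec, Matrix.one_mulVec, dotProduct_sub, ← Matrix.mulVec_mulVec,
        Matrix.dotProduct_mulVec, ← Matrix.star_mulVec, e₁, e₂, ← Complex.ofReal_sub]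
      exact_mod_cast sub_nonneg.2 (hC ξ)
  obtain ⟨D, hD⟩ := CStarAlgebra.nonneg_iff_eq_star_mul_self.mp hpsd.nonneg
  have hD' : C.conjTranspose * C + D.conjTranspose * D = 1 := by
    rw [Matrix.star_eq_conjTranspose] at hD
    rw [← hD, add_sub_cancel]
  have h1 : ∑ j, star (a j) * a j = (∑ i, star (∑ j, C i j • a j) * ∑ j, C i j • a j) +
      ∑ i, star (∑ j, D i j • a j) * ∑ j, D i j • a j := by
    rw [Matrix.sum_star_sum_smul_mul_sum_smul C, Matrix.sum_star_sum_smul_mul_sum_smul D,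
      ← Finset.sum_add_distrib]
    refine Finset.sum_congr rfl fun j _ => ?_
    rw [← Finset.sum_add_distrib]
    simp only [← add_smul, ← Matrix.add_apply, hD']
    simp [Matrix.one_apply, ite_smul]
  rw [h1]
  exact le_add_of_nonneg_right (Finset.sum_nonneg fun i _ => star_mul_self_nonneg _)

/-- A scalar kernel all of whose finite sections are contractions for the Euclidean norms. -/
def IsContractionKernel {ι : Type*} (c : ι → ι → ℂ) : Prop :=
  ∀ (M N : Finset ι) (ξ : ι → ℂ),
    ∑ m ∈ M, ‖∑ n ∈ N, c m n * ξ n‖ ^ 2 ≤ ∑ n ∈ N, ‖ξ n‖ ^ 2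

namespace IsContractionKernel

variable {ι : Type*} {c : ι → ι → ℂ} {A : Type*} [NonUnitalCStarAlgebra A]

theorem conj (hc : IsContractionKernel c) : IsContractionKernel fun m n => star (c m n) := by
  intro M N ξ
  refine le_of_eq_of_le ?_ ((hc M N fun n => star (ξ n)).trans_eq (by simp))
  refine Finset.sum_congr rfl fun m _ => ?_
  rw [← norm_star]
  simp [star_sum, mul_comm]

theorem sum_norm_sq_le (hc : IsContractionKernel c) (M : Finset ι) (n : ι) :
    ∑ m ∈ M, ‖c m n‖ ^ 2 ≤ 1 := by
  classical
  simpa using hc M {n} fun _ => 1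

theorem norm_sum_star_mul_le (hc : IsContractionKernel c) (M N : Finset ι) (a : ι → A) :
    ‖∑ m ∈ M, star (∑ n ∈ N, c m n • a n) * ∑ n ∈ N, c m n • a n‖ ≤ ∑ n ∈ N, ‖a n‖ ^ 2 := by
  let _ : PartialOrder A := CStarAlgebra.spectralOrder A
  have _ : StarOrderedRing A := CStarAlgebra.spectralOrderedRing A
  have h := Matrix.sum_star_mulVec_mul_mulVec_le (m := M) (n := N) (fun i j => c i j)
    (fun ξ => ?_) fun j => a j
  · simp only [Finset.sum_coe_sort M fun m => star (∑ j : N, c m j • a j) * ∑ j : N, c m j • a j,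
      Finset.sum_coe_sort N fun n => star (a n) * a n] at h
    have e : ∀ m, ∑ j : N, c m j • a j = ∑ n ∈ N, c m n • a n := fun m =>
      Finset.sum_coe_sort N fun n => c m n • a n
    simp only [e] at h
    refine (CStarAlgebra.norm_le_norm_of_nonneg_of_le
      (Finset.sum_nonneg fun m _ => star_mul_self_nonneg _) h).trans ?_
    refine (norm_sum_le _ _).trans_eq (Finset.sum_congr rfl fun n _ => ?_)
    rw [CStarRing.norm_star_mul_self, sq]
  · classical
    have h := hc M N fun n => if hn : n ∈ N then ξ ⟨n, hn⟩ else 0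
    rw [← Finset.sum_coe_sort M, ← Finset.sum_coe_sort N] at h
    simp only [← Finset.sum_coe_sort N, Finset.coe_mem, dite_true, Subtype.coe_eta] at h
    exact h

theorem norm_sum_mul_star_le (hc : IsContractionKernel c) (M N : Finset ι) (a : ι → A) :
    ‖∑ m ∈ M, (∑ n ∈ N, c m n • a n) * star (∑ n ∈ N, c m n • a n)‖ ≤ ∑ n ∈ N, ‖a n‖ ^ 2 := by
  have h := hc.conj.norm_sum_star_mul_le M N fun n => star (a n)
  simpa [star_sum] using h

theorem norm_sum_star_mul_le_of_hasSum (hc : IsContractionKernel c) (M : Finset ι) {a : ι → A}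
    {s : ι → A} (hs : ∀ m, HasSum (fun n => c m n • a n) (s m)) {t : ℝ}
    (ht : ∀ N : Finset ι, ∑ n ∈ N, ‖a n‖ ^ 2 ≤ t) :
    ‖∑ m ∈ M, star (s m) * s m‖ ≤ t ∧ ‖∑ m ∈ M, s m * star (s m)‖ ≤ t := by
  have h : ∀ m, Filter.Tendsto (fun N : Finset ι => ∑ n ∈ N, c m n • a n) Filter.atTop
    (nhds (s m)) := hs
  constructor
  · refine le_of_tendsto (tendsto_finsetSum M fun m _ => (h m).star.mul (h m)).norm ?_
    exact Filter.Eventually.of_forall fun N => (hc.norm_sum_star_mul_le M N a).trans (ht N)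
  · refine le_of_tendsto (tendsto_finsetSum M fun m _ => (h m).mul (h m).star).norm ?_
    exact Filter.Eventually.of_forall fun N => (hc.norm_sum_mul_star_le M N a).trans (ht N)

end IsContractionKernel
end ContractionKernel

section KernelTheorem

open Filter Topology

theorem Unitization.norm_snd_le {A : Type*} [NonUnitalCStarAlgebra A] (x : Unitization ℂ A) :
    ‖x.snd‖ ≤ 2 * ‖x‖ := by
  have h1 : ‖x.fst‖ ≤ ‖x‖ :=
    NonUnitalStarAlgHom.norm_apply_le (Unitization.fstHom ℂ A : Unitization ℂ A →⋆ₐ[ℂ] ℂ) x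
  have h2 : (Unitization.inr x.snd : Unitization ℂ A) = x - algebraMap ℂ _ x.fst := by
    rw [eq_sub_iff_add_eq, Unitization.algebraMap_eq_inl, add_comm]
    exact Unitization.inl_fst_add_inr_snd_eq x
  rw [← Unitization.norm_inr (𝕜 := ℂ), h2]
  refine (norm_sub_le _ _).trans ?_
  rw [norm_algebraMap']
  linarith

theorem norm_sum_map_inr_smul_le_one {C ι : Type*} [NonUnitalCStarAlgebra C] {γ : ℝ} (hγ : 0 < γ)
    {s : Finset ι} {f : ι → C} (h : ‖∑ i ∈ s, star (f i) * f i‖ ≤ γ ^ 2) :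
    ‖(s.toList.map fun i => star (Unitization.inr ((γ⁻¹ : ℂ) • f i) : Unitization ℂ C) *
      (Unitization.inr ((γ⁻¹ : ℂ) • f i) : Unitization ℂ C)).sum‖ ≤ 1 := by
  have e : (s.toList.map fun i => star (Unitization.inr ((γ⁻¹ : ℂ) • f i) : Unitization ℂ C) *
      (Unitization.inr ((γ⁻¹ : ℂ) • f i) : Unitization ℂ C)).sum =
      Unitization.inr (((γ⁻¹ : ℂ) * (γ⁻¹ : ℂ)) • ∑ i ∈ s, star (f i) * f i) := by
    rw [Finset.sum_map_toList, Finset.smul_sum]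
    refine Eq.trans ?_ (map_sum (Unitization.inrHom ℂ ℂ C) _ _).symm
    refine Finset.sum_congr rfl fun i _ => ?_
    change _ = Unitization.inr _
    rw [← Unitization.inr_star, ← Unitization.inr_mul, star_smul, smul_mul_smul_comm]
    simp
  rw [e, Unitization.norm_inr, norm_smul, norm_mul, norm_inv, Complex.norm_real,
    Real.norm_of_nonneg hγ.le, ← mul_inv, inv_mul_le_iff₀ (by positivity)]
  nlinarith

theorem exists_row_column_bound_finset {A B ι : Type*} [NonUnitalCStarAlgebra A]
    [NonUnitalCStarAlgebra B] (V : A →L[ℂ] B →L[ℂ] ℂ) :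
    ∃ K : ℝ, 0 ≤ K ∧ ∀ (s : Finset ι) (f : ι → A) (g : ι → B) (α β : ℝ), 0 < α → 0 < β →
      ‖∑ i ∈ s, star (f i) * f i‖ ≤ α ^ 2 → ‖∑ i ∈ s, f i * star (f i)‖ ≤ α ^ 2 →
      ‖∑ i ∈ s, star (g i) * g i‖ ≤ β ^ 2 → ‖∑ i ∈ s, g i * star (g i)‖ ≤ β ^ 2 →
      ‖∑ i ∈ s, V (f i) (g i)‖ ≤ K * α * β := by
  let W : Unitization ℂ A →ₗ[ℂ] Unitization ℂ B →ₗ[ℂ] ℂ :=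
    LinearMap.mk₂ ℂ (fun x y => V x.snd y.snd) (by simp) (by simp) (by simp) (by simp)
  obtain ⟨K, hK, h⟩ := exists_row_column_bound W (‖V‖ * 4) fun a b => by
    refine (V.le_opNorm₂ a.snd b.snd).trans ?_
    have := mul_le_mul (Unitization.norm_snd_le a) (Unitization.norm_snd_le b) (norm_nonneg _)
      (by positivity)
    nlinarith [norm_nonneg V]
  refine ⟨K, hK, fun s f g α β hα hβ h₁ h₂ h₃ h₄ => ?_⟩
  have h' := h (s.toList.map fun i => (Unitization.inr ((α⁻¹ : ℂ) • f i),
    Unitization.inr ((β⁻¹ : ℂ) • g i))) ?_ ?_ ?_ ?_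
  · simp only [List.map_map, Function.comp_def, W, LinearMap.mk₂_apply, Unitization.snd_inr,
      map_smul, smul_apply, Finset.sum_map_toList, ← Finset.smul_sum,
      smul_smul, norm_smul, norm_mul, norm_inv, Complex.norm_real, Real.norm_of_nonneg hα.le,
      Real.norm_of_nonneg hβ.le] at h'
    rw [← mul_inv, inv_mul_le_iff₀ (by positivity)] at h'
    linarith
  · rw [List.map_map]
    exact norm_sum_map_inr_smul_le_one hα h₁
  · rw [List.map_map]
    have := norm_sum_map_inr_smul_le_one (f := fun i => star (f i)) hα (s := s) (by simpa using h₂)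
    simpa [Function.comp_def, ← Unitization.inr_star] using this
  · rw [List.map_map]
    exact norm_sum_map_inr_smul_le_one hβ h₃
  · rw [List.map_map]
    have := norm_sum_map_inr_smul_le_one (f := fun i => star (g i)) hβ (s := s) (by simpa using h₄)
    simpa [Function.comp_def, ← Unitization.inr_star] using this

theorem summable_smul_of_sq {ι E : Type*} [NormedAddCommGroup E] [NormedSpace ℂ E]
    [CompleteSpace E] {c : ι → ℂ} {a : ι → E} (hc : ∀ M : Finset ι, ∑ m ∈ M, ‖c m‖ ^ 2 ≤ 1)
    (ha : Summable fun n => ‖a n‖ ^ 2) : Summable fun n => c n • a n := by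
  refine Summable.of_norm_bounded
    ((summable_of_sum_le (fun _ => sq_nonneg _) hc).add ha) fun n => ?_
  rw [norm_smul]
  nlinarith [sq_nonneg (‖c n‖ - ‖a n‖), sq_nonneg (‖c n‖ + ‖a n‖)]

theorem memℓp_two_dual {ι E : Type*} [NormedAddCommGroup E] [NormedSpace ℂ E] {a : ι → E}
    (ha : Summable fun n => ‖a n‖ ^ 2) (F : E →L[ℂ] ℂ) : Memℓp (fun n => F (a n)) 2 := by
  rw [memℓp_gen_iff (by simp)]
  refine Summable.of_nonneg_of_le (fun _ => by positivity) (fun n => ?_) (ha.mul_left (‖F‖ ^ 2))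
  rw [← mul_pow]
  simpa using pow_le_pow_left₀ (norm_nonneg _) (F.le_opNorm (a n)) 2

theorem exists_contractionKernel {ι A B : Type*} [NormedAddCommGroup A] [NormedSpace ℂ A]
    [CompleteSpace A] [NormedAddCommGroup B] [NormedSpace ℂ B] [CompleteSpace B]
    {a : ι → A} {b : ι → B} (ha : Summable fun n => ‖a n‖ ^ 2) (hb : Summable fun n => ‖b n‖ ^ 2)
    (h : ∀ (F : A →L[ℂ] ℂ) (G : B →L[ℂ] ℂ), ∑' n, F (a n) * G (b n) = 0) :
    ∃ c : ι → ι → ℂ, IsContractionKernel c ∧ IsContractionKernel (fun m n => c n m) ∧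
      (∀ m, HasSum (fun n => c m n • a n) 0) ∧ ∀ n, HasSum (fun m => c m n • b m) (b n) := by
  classical
  have h2 : 0 < (2 : ENNReal).toReal := by simp
  let vF : (A →L[ℂ] ℂ) → lp (fun _ : ι => ℂ) 2 := fun F => ⟨fun n => F (a n), memℓp_two_dual ha F⟩
  let vG : (B →L[ℂ] ℂ) → lp (fun _ : ι => ℂ) 2 := fun G => ⟨fun n => star (G (b n)), by
    refine (memℓp_gen_iff h2).2 ?_
    simpa using (memℓp_gen_iff h2).1 (memℓp_two_dual hb G)⟩
  let E : Submodule ℂ (lp (fun _ : ι => ℂ) 2) := Submodule.span ℂ (Set.range vF)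
  let Q := Eᗮ.starProjection
  let e : ι → lp (fun _ : ι => ℂ) 2 := fun n => lp.single 2 n 1
  have he : ∀ m x, inner ℂ (e m) x = x m := fun m x => by
    simp [e, lp.inner_single_left]
  let c : ι → ι → ℂ := fun m n => Q (e n) m
  have hcs : ∀ m n, c n m = star (c m n) := by
    intro m n
    simp only [c, ← he, Q]
    rw [← Submodule.inner_starProjection_left_eq_right, ← inner_conj_symm]
    rfl
  have hvG : ∀ G, vG G ∈ Eᗮ := by
    intro G
    rw [Submodule.mem_orthogonal]
    intro u hu
    induction hu using Submodule.span_induction with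
    | mem x hx =>
      obtain ⟨F, rfl⟩ := hx
      rw [lp.inner_eq_tsum]
      have h1 := congrArg star (h F G)
      rw [star_zero, tsum_star] at h1
      rw [← h1]
      refine tsum_congr fun n => ?_
      simp [vF, vG, mul_comm]
    | zero => simp
    | add x y _ _ hx hy => rw [inner_add_left, hx, hy, add_zero]
    | smul t x _ hx => rw [inner_smul_left, hx, mul_zero]
  have hc : IsContractionKernel c := by
    intro M N ξ
    let v : lp (fun _ : ι => ℂ) 2 := ∑ n ∈ N, lp.single 2 n (ξ n)
    have hv : ‖v‖ ^ 2 = ∑ n ∈ N, ‖ξ n‖ ^ 2 := by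
      simpa using lp.norm_sum_single h2 ξ N
    have hQ : ∀ m, Q v m = ∑ n ∈ N, c m n * ξ n := by
      intro m
      rw [← he, map_sum, inner_sum]
      refine Finset.sum_congr rfl fun n _ => ?_
      have : (lp.single 2 n (ξ n) : lp (fun _ : ι => ℂ) 2) = ξ n • e n := by
        rw [← lp.single_smul]; simp
      rw [this, map_smul, inner_smul_right, he, mul_comm]
    simp only [← hQ, ← hv]
    have h3 := lp.sum_rpow_le_norm_rpow h2 (Q v) M
    simp only [ENNReal.toReal_ofNat, Real.rpow_ofNat] at h3
    exact h3.trans (pow_le_pow_left₀ (norm_nonneg _) (Submodule.norm_starProjection_apply_le _ v) 2)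
  have hct : IsContractionKernel (fun m n => c n m) := by
    have : (fun m n => c n m) = fun m n => star (c m n) := by
      funext m n; exact hcs m n
    rw [this]
    exact hc.conj
  refine ⟨c, hc, hct, fun m => ?_, fun n => ?_⟩
  · have hs := (summable_smul_of_sq (fun M => hct.sum_norm_sq_le M m) ha)
    convert hs.hasSum using 1
    refine (SeparatingDual.eq_zero_of_forall_dual_eq_zero (R := ℂ) fun (F : A →L[ℂ] ℂ) => ?_).symm
    have h1 := hs.hasSum.mapL F
    have h2 : inner ℂ (Q (e m)) (vF F) = 0 :=
      Submodule.inner_left_of_mem_orthogonal (Submodule.subset_span (Set.mem_range_self F))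
        (Submodule.starProjection_apply_mem _ _)
    have h3 := lp.hasSum_inner (𝕜 := ℂ) (G := fun _ : ι => ℂ) (Q (e m)) (vF F)
    rw [h2] at h3
    refine h1.unique (h3.congr_fun fun n => ?_)
    rw [RCLike.inner_apply, map_smul, smul_eq_mul, mul_comm]
    exact congrArg (F (a n) * ·) (hcs n m)
  · have hs := (summable_smul_of_sq (fun M => hc.sum_norm_sq_le M n) hb)
    convert hs.hasSum using 1
    rw [← sub_eq_zero]
    refine (SeparatingDual.eq_zero_of_forall_dual_eq_zero (R := ℂ) fun G => ?_)
    have h1 := hs.hasSum.mapL G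
    have h3 := lp.hasSum_inner (𝕜 := ℂ) (G := fun _ : ι => ℂ) (vG G) (Q (e n))
    have h2 : inner ℂ (vG G) (Q (e n)) = G (b n) := by
      rw [← Submodule.inner_starProjection_left_eq_right,
        Submodule.starProjection_eq_self_iff.2 (hvG G), ← inner_conj_symm, he]
      simp [vG]
    rw [h2] at h3
    rw [map_sub, sub_eq_zero]
    refine h3.unique (h1.congr_fun fun m => ?_)
    rw [RCLike.inner_apply, map_smul, smul_eq_mul]
    simp [vG, c]

theorem Summable.eventually_sum_ite_lt {ι : Type*} [DecidableEq ι] {f : ι → ℝ} (hf : Summable f)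
    {ε : ℝ} (hε : 0 < ε) :
    ∀ᶠ N : Finset ι in atTop, ∀ N' : Finset ι, ∑ n ∈ N', (if n ∈ N then 0 else f n) ≤ ε := by
  obtain ⟨s, hs⟩ := summable_iff_vanishing_norm.1 hf ε hε
  filter_upwards [eventually_ge_atTop s] with N hN N'
  have := hs (N'.filter (· ∉ N)) (Finset.disjoint_left.2 fun x hx hxs =>
    (Finset.mem_filter.1 hx).2 (hN hxs))
  rw [Finset.sum_filter] at this
  simp only [ite_not] at this
  exact (le_abs_self _).trans this.le

theorem norm_sum_star_mul_le_tsum {ι A : Type*} [NonUnitalCStarAlgebra A] {a : ι → A}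
    (ha : Summable fun n => ‖a n‖ ^ 2) (N : Finset ι) :
    ‖∑ n ∈ N, star (a n) * a n‖ ≤ (∑' n, ‖a n‖ ^ 2 + 1) ^ 2 ∧
      ‖∑ n ∈ N, a n * star (a n)‖ ≤ (∑' n, ‖a n‖ ^ 2 + 1) ^ 2 := by
  have h0 : ∑ n ∈ N, ‖a n‖ ^ 2 ≤ ∑' n, ‖a n‖ ^ 2 := ha.sum_le_tsum N fun _ _ => sq_nonneg _
  have h1 : 0 ≤ ∑' n, ‖a n‖ ^ 2 := tsum_nonneg fun _ => sq_nonneg _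
  have h2 : ∑ n ∈ N, ‖a n‖ ^ 2 ≤ (∑' n, ‖a n‖ ^ 2 + 1) ^ 2 := by nlinarith
  refine ⟨(norm_sum_le_of_le N fun n _ => ?_).trans h2, (norm_sum_le_of_le N fun n _ => ?_).trans h2⟩
  · rw [CStarRing.norm_star_mul_self, sq]
  · rw [CStarRing.norm_self_mul_star, sq]

theorem norm_ite_zero_sq {ι E : Type*} [DecidableEq ι] [NormedAddCommGroup E] (N : Finset ι) (x : E)
    (n : ι) : ‖if n ∈ N then 0 else x‖ ^ 2 = if n ∈ N then 0 else ‖x‖ ^ 2 := by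
  split_ifs <;> simp

theorem HasSum.smul_ite_zero {ι E : Type*} [DecidableEq ι] [NormedAddCommGroup E] [NormedSpace ℂ E]
    {c : ι → ℂ} {a : ι → E} {s : E} (h : HasSum (fun n => c n • a n) s) (N : Finset ι) :
    HasSum (fun n => c n • if n ∈ N then 0 else a n) (s - ∑ n ∈ N, c n • a n) := by
  have h1 : HasSum (fun n => if n ∈ N then c n • a n else 0) (∑ n ∈ N, c n • a n) := by
    have : HasSum (fun n => if n ∈ N then c n • a n else 0)
        (∑ n ∈ N, if n ∈ N then c n • a n else 0) :=
      hasSum_sum_of_ne_finset_zero fun n hn => if_neg hn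
    rwa [Finset.sum_congr rfl fun n hn => if_pos hn] at this
  refine (h.sub h1).congr_fun fun n => ?_
  split_ifs <;> simp

/-- A bounded bilinear form cannot detect a nuclear series which is annihilated by all products of
functionals. -/
theorem tsum_bilinear_eq_zero {ι A B : Type*} [NonUnitalCStarAlgebra A]
    [NonUnitalCStarAlgebra B] (V : A →L[ℂ] B →L[ℂ] ℂ) {a : ι → A} {b : ι → B}
    (ha : Summable fun n => ‖a n‖ ^ 2) (hb : Summable fun n => ‖b n‖ ^ 2)
    (h : ∀ (F : A →L[ℂ] ℂ) (G : B →L[ℂ] ℂ), ∑' n, F (a n) * G (b n) = 0) :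
    ∑' n, V (a n) (b n) = 0 := by
  classical
  obtain ⟨K, hK, hV⟩ := exists_row_column_bound_finset (ι := ι) V
  obtain ⟨c, hc, hct, hca, hcb⟩ := exists_contractionKernel ha hb h
  have hsum : Summable fun n => V (a n) (b n) := by
    refine Summable.of_norm_bounded ((ha.add hb).mul_left ‖V‖) fun n => ?_
    refine (V.le_opNorm₂ (a n) (b n)).trans ?_
    rw [mul_assoc]
    refine mul_le_mul_of_nonneg_left ?_ (norm_nonneg V)
    nlinarith [sq_nonneg (‖a n‖ - ‖b n‖), sq_nonneg (‖a n‖ + ‖b n‖)]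
  set α := ∑' n, ‖a n‖ ^ 2 + 1
  set β := ∑' n, ‖b n‖ ^ 2 + 1
  have hα : 0 < α := add_pos_of_nonneg_of_pos (tsum_nonneg fun _ => sq_nonneg _) one_pos
  have hβ : 0 < β := add_pos_of_nonneg_of_pos (tsum_nonneg fun _ => sq_nonneg _) one_pos
  have key : ∀ ε : ℝ, 0 < ε → ‖∑' n, V (a n) (b n)‖ ≤ K * α * ε + K * ε * β := by
    intro ε hε
    refine le_of_tendsto (hsum.hasSum.norm : Tendsto _ _ _) ?_
    filter_upwards [ha.eventually_sum_ite_lt (pow_pos hε 2),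
      hb.eventually_sum_ite_lt (pow_pos hε 2)] with N hNa hNb
    let sa : ι → A := fun m => ∑ n ∈ N, c m n • a n
    let sb : ι → B := fun n => ∑ m ∈ N, c m n • b m
    have ea := hc.norm_sum_star_mul_le_of_hasSum N (fun m => (hca m).smul_ite_zero N) (t := ε ^ 2)
      (by simpa only [norm_ite_zero_sq] using hNa)
    have eb := hct.norm_sum_star_mul_le_of_hasSum N (fun n => (hcb n).smul_ite_zero N) (t := ε ^ 2)
      (by simpa only [norm_ite_zero_sq] using hNb)
    have split : ∑ n ∈ N, V (a n) (b n) =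
        ∑ n ∈ N, V (a n) (b n - sb n) - ∑ m ∈ N, V (0 - sa m) (b m) := by
      simp only [map_sub, Finset.sum_sub_distrib, sub_apply, map_zero, zero_apply,
        sa, sb, map_sum, map_smul, sum_apply, smul_apply]
      rw [Finset.sum_comm]
      simp
    rw [split]
    have na := norm_sum_star_mul_le_tsum ha N
    have nb := norm_sum_star_mul_le_tsum hb N
    exact (norm_sub_le _ _).trans (add_le_add
      (hV N a (fun n => b n - sb n) α ε hα hε na.1 na.2 eb.1 eb.2)
      (hV N (fun m => 0 - sa m) b ε β hε hβ ea.1 ea.2 nb.1 nb.2))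
  have lim : Tendsto (fun ε : ℝ => K * α * ε + K * ε * β) (𝓝[>] 0) (𝓝 0) := by
    refine (Continuous.tendsto' (by fun_prop) 0 0 (by simp)).mono_left nhdsWithin_le_nhds
  exact norm_le_zero_iff.1 (ge_of_tendsto lim (eventually_mem_nhdsWithin.mono key))

end KernelTheorem

namespace CStarProjTensor

variable {A B : Type u} [NonUnitalCStarAlgebra A] [NonUnitalCStarAlgebra B]
  (P : CStarProjTensor A B)

theorem continuousLinearMap_ext {X : Type*} [NormedAddCommGroup X] [NormedSpace ℂ X]
    {f g : P.T →L[ℂ] X} (h : ∀ a b, f (P.tmul a b) = g (P.tmul a b)) : f = g := by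
  have hd : Dense (Submodule.span ℂ {t : P.T | ∃ a b, t = P.tmul a b} : Set P.T) :=
    dense_iff_closure_eq.2 P.span_dense
  refine ContinuousLinearMap.ext_on hd ?_
  rintro _ ⟨a, b, rfl⟩
  exact h a b

theorem norm_lpSum_le (f : lp (fun _ : A × B => ℂ) 1) (w : A × B → P.T) (hw : ∀ p, ‖w p‖ ≤ 1) :
    (Summable fun p => f p • w p) ∧ ‖∑' p, f p • w p‖ ≤ 1 * ‖f‖ := by
  have h1 := lp.hasSum_norm (p := 1) (by simp) f
  simp only [ENNReal.toReal_one, Real.rpow_one] at h1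
  have h2 : ∀ p, ‖f p • w p‖ ≤ ‖f p‖ := fun p => by
    rw [norm_smul]; exact mul_le_of_le_one_right (norm_nonneg _) (hw p)
  exact ⟨.of_norm_bounded h1.summable h2, by rw [one_mul]; exact tsum_of_norm_bounded h1 h2⟩

/-- The synthesis map from `ℓ¹` to `T` attached to a bounded family. -/
noncomputable def synthesis (w : A × B → P.T) (hw : ∀ p, ‖w p‖ ≤ 1) :
    lp (fun _ : A × B => ℂ) 1 →L[ℂ] P.T :=
  LinearMap.mkContinuous
    { toFun := fun f => ∑' p, f p • w p
      map_add' := fun f g => by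
        rw [← (P.norm_lpSum_le f w hw).1.tsum_add (P.norm_lpSum_le g w hw).1]
        exact tsum_congr fun p => by simp [add_smul]
      map_smul' := fun c f => by
        rw [RingHom.id_apply, ← (P.norm_lpSum_le f w hw).1.tsum_const_smul c]
        exact tsum_congr fun p => by simp [mul_smul] }
    1 fun f => (P.norm_lpSum_le f w hw).2

theorem synthesis_surjective {w : A × B → P.T} (hw : ∀ p, ‖w p‖ ≤ 1)
    (hw' : ∀ p, ((‖p.1‖ * ‖p.2‖ : ℝ) : ℂ) • w p = P.tmul p.1 p.2) :
    Function.Surjective (P.synthesis w hw) := by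
  classical
  set Φ := P.synthesis w hw
  let N := LinearMap.ker (Φ : lp (fun _ : A × B => ℂ) 1 →ₗ[ℂ] P.T)
  have hN : IsClosed (N : Set (lp (fun _ : A × B => ℂ) 1)) := Φ.isClosed_ker
  let Ψ : (lp (fun _ : A × B => ℂ) 1 ⧸ N) →L[ℂ] P.T := N.liftQL Φ le_rfl
  have hΨ : Function.Injective Ψ := LinearMap.ker_eq_bot.1 (Submodule.ker_liftQ_eq_bot _ _ _ le_rfl)
  let β₀ : A → B → lp (fun _ : A × B => ℂ) 1 ⧸ N := fun a b =>
    Submodule.Quotient.mk (lp.single 1 (a, b) ((‖a‖ * ‖b‖ : ℝ) : ℂ))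
  have hβ₀ : ∀ a b, Ψ (β₀ a b) = P.tmul a b := by
    intro a b
    rw [← hw' (a, b)]
    change ∑' p, (lp.single 1 (a, b) ((‖a‖ * ‖b‖ : ℝ) : ℂ) : lp (fun _ : A × B => ℂ) 1) p • w p = _
    rw [tsum_eq_single (a, b)]
    · rw [lp.single_apply_self]
    · intro p hp
      rw [lp.single_apply_ne _ _ _ hp, zero_smul]
  let β : A →L[ℂ] B →L[ℂ] (lp (fun _ : A × B => ℂ) 1 ⧸ N) := LinearMap.mkContinuous₂
    (LinearMap.mk₂ ℂ β₀ (fun _ _ _ => hΨ (by simp [hβ₀])) (fun _ _ _ => hΨ (by simp [hβ₀]))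
      (fun _ _ _ => hΨ (by simp [hβ₀])) (fun _ _ _ => hΨ (by simp [hβ₀]))) 1 fun a b => by
        refine (Submodule.Quotient.norm_mk_le N _).trans ?_
        rw [lp.norm_single one_pos]
        simp
  obtain ⟨L, hL, -⟩ := P.lift _ β
  have hid : Ψ.comp L = .id ℂ P.T := P.continuousLinearMap_ext fun a b => by
    simp only [ContinuousLinearMap.comp_apply, hL]
    exact hβ₀ a b
  intro x
  obtain ⟨f, hf⟩ := Submodule.Quotient.mk_surjective N (L x)
  refine ⟨f, ?_⟩
  have := congrArg (fun g => g x) hid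
  simp only [ContinuousLinearMap.comp_apply, ← hf] at this
  exact this

/-- Every element of the projective tensor product is the sum of a nuclear series. -/
theorem exists_series (x : P.T) : ∃ (a : A × B → A) (b : A × B → B),
    (Summable fun n => ‖a n‖ ^ 2) ∧ (Summable fun n => ‖b n‖ ^ 2) ∧
      HasSum (fun n => P.tmul (a n) (b n)) x := by
  have hu : ∀ {E : Type u} [NormedAddCommGroup E] [NormedSpace ℂ E] (x : E),
      ‖((‖x‖ : ℂ)⁻¹) • x‖ ≤ 1 := by
    intro E _ _ x
    rw [norm_smul, norm_inv, Complex.norm_real, norm_norm]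
    exact inv_mul_le_one
  let w : A × B → P.T := fun p => P.tmul ((‖p.1‖ : ℂ)⁻¹ • p.1) ((‖p.2‖ : ℂ)⁻¹ • p.2)
  have hw : ∀ p, ‖w p‖ ≤ 1 := fun p => by
    rw [P.norm_tmul]
    exact mul_le_one₀ (hu _) (norm_nonneg _) (hu _)
  obtain ⟨f, hf⟩ := P.synthesis_surjective hw (fun p => by
    rcases eq_or_ne p.1 0 with h | h
    · simp [h]
    rcases eq_or_ne p.2 0 with h' | h'
    · simp [h']
    simp only [w, map_smul, LinearMap.smul_apply, smul_smul]
    have h1 : (‖p.1‖ : ℂ) ≠ 0 := by simpa using h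
    have h2 : (‖p.2‖ : ℂ) ≠ 0 := by simpa using h'
    push_cast
    convert one_smul ℂ _ using 2
    field_simp) x
  have hs := lp.hasSum_norm (p := 1) (by simp) f
  simp only [ENNReal.toReal_one, Real.rpow_one] at hs
  refine ⟨fun p => ((√‖f p‖ : ℝ) : ℂ) • (‖p.1‖ : ℂ)⁻¹ • p.1,
    fun p => (f p / ((√‖f p‖ : ℝ) : ℂ)) • (‖p.2‖ : ℂ)⁻¹ • p.2, ?_, ?_, ?_⟩
  · refine hs.summable.of_nonneg_of_le (fun _ => sq_nonneg _) fun p => ?_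
    rw [norm_smul, mul_pow, Complex.norm_real, Real.norm_of_nonneg (Real.sqrt_nonneg _),
      Real.sq_sqrt (norm_nonneg _)]
    exact mul_le_of_le_one_right (norm_nonneg _) (pow_le_one₀ (norm_nonneg _) (hu _))
  · refine hs.summable.of_nonneg_of_le (fun _ => sq_nonneg _) fun p => ?_
    rw [norm_smul, mul_pow, norm_div, Complex.norm_real, Real.norm_of_nonneg (Real.sqrt_nonneg _),
      Real.div_sqrt, Real.sq_sqrt (norm_nonneg _)]
    exact mul_le_of_le_one_right (norm_nonneg _) (pow_le_one₀ (norm_nonneg _) (hu _))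
  · have h1 : HasSum (fun p => f p • w p) x := by
      rw [← hf]
      exact (P.norm_lpSum_le f w hw).1.hasSum
    refine h1.congr_fun fun p => ?_
    simp only [w, map_smul, LinearMap.smul_apply, smul_smul]
    congr 1
    have e : f p / ((√‖f p‖ : ℝ) : ℂ) * ((√‖f p‖ : ℝ) : ℂ) = f p := by
      rcases eq_or_ne (f p) 0 with h | h
      · simp [h]
      · exact div_mul_cancel₀ _ (by simpa using (Real.sqrt_pos.2 (norm_pos_iff.2 h)).ne')
    linear_combination ((‖p.1‖ : ℂ)⁻¹ * (‖p.2‖ : ℂ)⁻¹) * e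

/-- The left slice map `a ⊗ b ↦ F a • b`. -/
noncomputable def sliceLeft (F : A →L[ℂ] ℂ) : P.T →L[ℂ] B :=
  (P.lift B (F.smulRight (.id ℂ B))).choose

theorem sliceLeft_tmul (F : A →L[ℂ] ℂ) (a : A) (b : B) :
    P.sliceLeft F (P.tmul a b) = F a • b :=
  (P.lift B (F.smulRight (.id ℂ B))).choose_spec.1 a b

/-- The right slice map `a ⊗ b ↦ G b • a`. -/
noncomputable def sliceRight (G : B →L[ℂ] ℂ) : P.T →L[ℂ] A :=
  (P.lift A (ContinuousLinearMap.smulRightL ℂ B A G)).choose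

theorem sliceRight_tmul (G : B →L[ℂ] ℂ) (a : A) (b : B) :
    P.sliceRight G (P.tmul a b) = G b • a :=
  (P.lift A (ContinuousLinearMap.smulRightL ℂ B A G)).choose_spec.1 a b

theorem eq_zero_of_sliceLeft_eq_zero {x : P.T} (h : ∀ F, P.sliceLeft F x = 0) : x = 0 := by
  obtain ⟨a, b, ha, hb, hs⟩ := P.exists_series x
  refine SeparatingDual.eq_zero_of_forall_dual_eq_zero (R := ℂ) fun (V : P.T →L[ℂ] ℂ) => ?_
  let W : A →L[ℂ] B →L[ℂ] ℂ :=
    LinearMap.mkContinuous₂ (P.tmul.compr₂ (V : P.T →ₗ[ℂ] ℂ)) ‖V‖ fun a b => by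
      rw [mul_assoc, ← P.norm_tmul]
      exact V.le_opNorm _
  have h1 := tsum_bilinear_eq_zero W ha hb fun F G => by
    have h2 := (hs.mapL (P.sliceLeft F)).mapL G
    simp only [sliceLeft_tmul, map_smul, smul_eq_mul, h F, map_zero] at h2
    exact h2.tsum_eq
  rw [← h1]
  exact (hs.mapL V).tsum_eq.symm

end CStarProjTensor

section Excision

variable {A : Type*} [NonUnitalCStarAlgebra A]

section Order

variable [PartialOrder A] [StarOrderedRing A]

theorem exists_mul_ne_zero_smul_le {x a : A} (ha : IsSelfAdjoint a) {η : ℝ}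
    (h : ¬ star x * a * x ≤ η • (star x * x)) :
    ∃ k, x * k ≠ 0 ∧ η • (star (x * k) * (x * k)) ≤ star (x * k) * a * (x * k) := by
  obtain ⟨d, hd⟩ : ∃ d, d = star x * a * x - η • (star x * x) := ⟨_, rfl⟩
  have hds : IsSelfAdjoint d := hd ▸ (ha.conjugate' x).sub ((IsSelfAdjoint.all η).smul (.star_mul_self x))
  have hk : 0 ≤ d⁺ := CFC.posPart_nonneg d
  have hks : star d⁺ = d⁺ := (IsSelfAdjoint.of_nonneg hk).star_eq
  have e1 : star (x * d⁺) * a * (x * d⁺) - η • (star (x * d⁺) * (x * d⁺)) = d⁺ * d * d⁺ := by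
    rw [star_mul, hks]
    generalize d⁺ = e
    rw [hd]
    simp only [mul_sub, sub_mul, mul_smul_comm, smul_mul_assoc, mul_assoc]
  have e2 : d⁺ * d * d⁺ = d⁺ * d⁺ * d⁺ := by
    calc d⁺ * d * d⁺ = d⁺ * (d⁺ - d⁻) * d⁺ := by rw [CFC.posPart_sub_negPart d hds]
      _ = d⁺ * d⁺ * d⁺ := by rw [mul_sub, CFC.posPart_mul_negPart, sub_zero]
  refine ⟨d⁺, fun h0 => h ?_, ?_⟩
  · have h3 : d⁺ * d⁺ * d⁺ = 0 := by
      rw [← e2, ← e1, h0]; simp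
    have h2 : d⁺ * d⁺ = 0 := by
      rw [← CStarRing.star_mul_self_eq_zero_iff, star_mul, hks, ← mul_assoc, h3, zero_mul]
    have h1 : d⁺ = 0 := by
      rwa [← CStarRing.star_mul_self_eq_zero_iff, hks]
    rw [← sub_nonpos, ← hd, ← CFC.posPart_sub_negPart d hds, h1, zero_sub]
    exact neg_nonpos.2 (CFC.negPart_nonneg d)
  · rw [← sub_nonneg, e1, e2]
    simpa [hks] using star_left_conjugate_nonneg hk d⁺

end Order

/-- The compression of `a` by any multiple of `y` is close to the scalar `μ`. -/
def Excises (a : A) (μ : ℂ) (ε : ℝ) (y : A) : Prop :=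
  ∀ k, ‖star (y * k) * a * (y * k) - μ • (star (y * k) * (y * k))‖ ≤ ε * ‖y * k‖ ^ 2

theorem Excises.mul {a : A} {μ : ℂ} {ε : ℝ} {y : A} (h : Excises a μ ε y) (k : A) :
    Excises a μ ε (y * k) := fun k' => by
  simpa only [mul_assoc] using h (k * k')

theorem exists_excises_of_isSelfAdjoint {x a : A} (hx : x ≠ 0) (ha : IsSelfAdjoint a) {ε : ℝ}
    (hε : 0 < ε) : ∃ (k : A) (μ : ℂ), x * k ≠ 0 ∧ Excises a μ ε (x * k) := by
  classical
  let _ : PartialOrder A := CStarAlgebra.spectralOrder A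
  have _ : StarOrderedRing A := CStarAlgebra.spectralOrderedRing A
  have hex : ∃ n : ℕ, ¬ star x * a * x ≤ (‖a‖ - n * ε) • (star x * x) := by
    obtain ⟨n, hn⟩ := exists_nat_gt (2 * ‖a‖ / ε)
    refine ⟨n, fun h => ?_⟩
    have h1 : -(star x * a * x) ≤ ‖a‖ • (star x * x) := by
      simpa using CStarAlgebra.star_left_conjugate_le_norm_smul (a := x) ha.neg
    have h2 := add_le_add h h1
    rw [add_neg_cancel, ← add_smul] at h2
    have hc : ‖a‖ - n * ε + ‖a‖ < 0 := by
      rw [div_lt_iff₀ hε] at hn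
      linarith
    have h3 := smul_nonneg (neg_nonneg.2 hc.le) (star_mul_self_nonneg x)
    rw [neg_smul, neg_nonneg] at h3
    exact hx (by simpa [hc.ne] using le_antisymm h3 h2)
  obtain ⟨n, hn⟩ : ∃ n : ℕ, star x * a * x ≤ (‖a‖ - n * ε) • (star x * x) ∧
      ¬ star x * a * x ≤ (‖a‖ - n * ε - ε) • (star x * x) := by
    have h0 : Nat.find hex ≠ 0 := fun h => by
      have := Nat.find_spec hex
      rw [h] at this
      exact this (by simpa using CStarAlgebra.star_left_conjugate_le_norm_smul ha)
    obtain ⟨m, hm⟩ := Nat.exists_eq_succ_of_ne_zero h0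
    refine ⟨m, not_not.1 (Nat.find_min hex (m := m) (by omega)), ?_⟩
    have := Nat.find_spec hex
    rw [hm] at this
    convert this using 3
    push_cast
    ring
  obtain ⟨k, hk, hle⟩ := exists_mul_ne_zero_smul_le ha hn.2
  refine ⟨k, ((‖a‖ - n * ε - ε : ℝ) : ℂ), hk, fun k' => ?_⟩
  have l1 := star_left_conjugate_le_conjugate hle k'
  have l2 := star_left_conjugate_le_conjugate hn.1 (k * k')
  have e1 : ∀ b y : A, star k' * (star y * b * y) * k' = star (y * k') * b * (y * k') := by
    intro b y; simp only [star_mul, mul_assoc]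
  have e2 : ∀ b : A, star (k * k') * (star x * b * x) * (k * k') =
      star (x * k * k') * b * (x * k * k') := by
    intro b; simp only [star_mul, mul_assoc]
  set y := x * k * k' with hy
  have l3 : (‖a‖ - n * ε - ε) • (star y * y) ≤ star y * a * y := by
    simpa [hy, mul_assoc, mul_smul_comm, smul_mul_assoc] using l1
  have l4 : star y * a * y ≤ (‖a‖ - n * ε) • (star y * y) := by
    simpa [hy, mul_assoc, mul_smul_comm, smul_mul_assoc] using l2
  have l5 : star y * a * y - (‖a‖ - n * ε - ε) • (star y * y) ≤ ε • (star y * y) := by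
    rw [sub_le_iff_le_add, ← add_smul]
    simpa using l4
  rw [Complex.coe_smul]
  refine (CStarAlgebra.norm_le_norm_of_nonneg_of_le (sub_nonneg.2 l3) l5).trans_eq ?_
  rw [norm_smul, CStarRing.norm_star_mul_self, Real.norm_of_nonneg hε.le, sq]

theorem exists_excises {x : A} (hx : x ≠ 0) (a : A) {ε : ℝ} (hε : 0 < ε) :
    ∃ (k : A) (μ : ℂ), x * k ≠ 0 ∧ Excises a μ ε (x * k) := by
  obtain ⟨k, μ, hk, h1⟩ := exists_excises_of_isSelfAdjoint hx (ℜ a).2 (half_pos hε)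
  obtain ⟨k', ν, hk', h2⟩ := exists_excises_of_isSelfAdjoint hk (ℑ a).2 (half_pos hε)
  refine ⟨k * k', μ + Complex.I * ν, by rwa [← mul_assoc], ?_⟩
  rw [← mul_assoc]
  intro w
  have h1 := h1.mul k' w
  have h2 := h2 w
  generalize x * k * k' * w = y at h1 h2
  have e : star y * a * y - (μ + Complex.I * ν) • (star y * y) =
      (star y * (ℜ a : A) * y - μ • (star y * y)) +
        Complex.I • (star y * (ℑ a : A) * y - ν • (star y * y)) := by
    conv_lhs => rw [← realPart_add_I_smul_imaginaryPart a]
    simp only [mul_add, add_mul, mul_smul_comm, smul_mul_assoc, add_smul, smul_sub, mul_smul]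
    abel
  rw [e]
  refine (norm_add_le _ _).trans ?_
  rw [norm_smul, Complex.norm_I, one_mul]
  linarith

theorem exists_excises_finset {ι : Type*} {x : A} (hx : x ≠ 0) (a : ι → A) (s : Finset ι) {ε : ℝ}
    (hε : 0 < ε) : ∃ (k : A) (μ : ι → ℂ), x * k ≠ 0 ∧ ∀ i ∈ s, Excises (a i) (μ i) ε (x * k) := by
  classical
  induction s using Finset.induction_on with
  | empty => exact ⟨star x, 0, by simpa using hx, by simp⟩
  | insert i s hi ih =>
    obtain ⟨k, μ, hk, h⟩ := ih
    obtain ⟨k', ν, hk', h'⟩ := exists_excises hk (a i) hε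
    refine ⟨k * k', Function.update μ i ν, by rwa [← mul_assoc], fun j hj => ?_⟩
    rw [← mul_assoc]
    by_cases hji : j = i
    · subst hji
      simpa using h'
    · rw [Function.update_of_ne hji]
      exact (h j (Finset.mem_of_mem_insert_of_ne hj hji)).mul k'

section Order

variable [PartialOrder A] [StarOrderedRing A]

theorem norm_le_three_mul_of_neg_le_of_le {a b : A} (h1 : -b ≤ a) (h2 : a ≤ b) :
    ‖a‖ ≤ 3 * ‖b‖ := by
  have h3 : 0 ≤ a + b := by simpa using add_le_add_left h1 b
  have h4 : a + b ≤ b + b := by gcongr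
  have h5 := CStarAlgebra.norm_le_norm_of_nonneg_of_le h3 h4
  have h6 := norm_add_le b b
  have h7 : ‖a‖ ≤ ‖a + b‖ + ‖b‖ := by simpa using norm_sub_le (a + b) b
  linarith

end Order

theorem exists_compression_lower_bound_of_isSelfAdjoint {h : A} (hs : IsSelfAdjoint h)
    (h0 : h ≠ 0) : ∃ η > 0, ∃ x : A, x ≠ 0 ∧
      ∀ k, η * ‖x * k‖ ^ 2 ≤ ‖star (x * k) * h * (x * k)‖ := by
  let _ : PartialOrder A := CStarAlgebra.spectralOrder A
  have _ : StarOrderedRing A := CStarAlgebra.spectralOrderedRing A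
  have hp : 0 < ‖h‖ := norm_pos_iff.2 h0
  have key : ∀ a : A, (a = h ∨ a = -h) → ∀ η : ℝ, 0 < η →
      ¬ star h * a * h ≤ η • (star h * h) → ∃ η > 0, ∃ x : A, x ≠ 0 ∧
      ∀ k, η * ‖x * k‖ ^ 2 ≤ ‖star (x * k) * h * (x * k)‖ := by
    intro a ha η hη hn
    have has : IsSelfAdjoint a := by
      rcases ha with rfl | rfl
      exacts [hs, hs.neg]
    obtain ⟨k, hk, hle⟩ := exists_mul_ne_zero_smul_le has hn
    refine ⟨η, hη, h * k, hk, fun w => ?_⟩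
    have l1 := star_left_conjugate_le_conjugate hle w
    set y := h * k * w with hy
    have l2 : η • (star y * y) ≤ star y * a * y := by
      simpa [hy, mul_assoc, mul_smul_comm, smul_mul_assoc] using l1
    have l3 := CStarAlgebra.norm_le_norm_of_nonneg_of_le
      (smul_nonneg hη.le (star_mul_self_nonneg y)) l2
    rw [norm_smul, CStarRing.norm_star_mul_self, Real.norm_of_nonneg hη.le, ← sq] at l3
    rcases ha with rfl | rfl
    · exact l3
    · simpa using l3
  by_contra hcon
  have c1 := not_not.1 (mt (key h (.inl rfl) (‖h‖ / 4) (by positivity)) hcon)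
  have c2 := not_not.1 (mt (key (-h) (.inr rfl) (‖h‖ / 4) (by positivity)) hcon)
  rw [mul_neg, neg_mul, neg_le] at c2
  have := norm_le_three_mul_of_neg_le_of_le c2 c1
  have e1 : ‖star h * h * h‖ * ‖h‖ = ‖h‖ ^ 4 := by
    have e2 : ‖h * h‖ = ‖h‖ * ‖h‖ := by
      have := CStarRing.norm_star_mul_self (x := h)
      rwa [hs.star_eq] at this
    have e3 := CStarRing.norm_star_mul_self (x := h * h)
    rw [star_mul, hs.star_eq, e2] at e3
    rw [hs.star_eq]
    refine le_antisymm ?_ ?_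
    · calc _ ≤ ‖h * h‖ * ‖h‖ * ‖h‖ := by gcongr; exact norm_mul_le _ _
        _ = _ := by rw [e2]; ring
    · calc ‖h‖ ^ 4 = ‖h * h * h * h‖ := by rw [mul_assoc (h * h), e3]; ring
        _ ≤ _ := norm_mul_le _ _
  rw [norm_smul, CStarRing.norm_star_mul_self, Real.norm_of_nonneg (by positivity)] at this
  have : ‖star h * h * h‖ * ‖h‖ ≤ 3 * (‖h‖ / 4 * (‖h‖ * ‖h‖)) * ‖h‖ := by gcongr
  rw [e1] at this
  nlinarith [pow_pos hp 4]

theorem exists_compression_lower_bound {c : A} (h0 : c ≠ 0) : ∃ η > 0, ∃ x : A, x ≠ 0 ∧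
      ∀ k, η * ‖x * k‖ ^ 2 ≤ ‖star (x * k) * c * (x * k)‖ := by
  have hre : ∀ d : A, ‖(ℜ d : A)‖ ≤ ‖d‖ := fun d => realPart.norm_le d
  have hri : ∀ d : A, ‖(ℑ d : A)‖ ≤ ‖d‖ := fun d => imaginaryPart.norm_le d
  by_cases hr : (ℜ c : A) = 0
  · have hi : (ℑ c : A) ≠ 0 := fun hi => h0 (by
      rw [← realPart_add_I_smul_imaginaryPart c, hr, hi]; simp)
    obtain ⟨η, hη, x, hx, h⟩ := exists_compression_lower_bound_of_isSelfAdjoint (ℑ c).2 hi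
    refine ⟨η, hη, x, hx, fun k => (h k).trans ?_⟩
    refine le_trans (le_of_eq ?_) (hri _)
    rw [imaginaryPart_apply_coe, imaginaryPart_apply_coe]
    simp [mul_sub, sub_mul, mul_smul_comm, smul_mul_assoc, mul_assoc]
  · obtain ⟨η, hη, x, hx, h⟩ := exists_compression_lower_bound_of_isSelfAdjoint (ℜ c).2 hr
    refine ⟨η, hη, x, hx, fun k => (h k).trans ?_⟩
    refine le_trans (le_of_eq ?_) (hre _)
    rw [realPart_apply_coe, realPart_apply_coe]
    simp [mul_add, add_mul, mul_smul_comm, smul_mul_assoc, mul_assoc]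

theorem exists_norm_mul_le_two_mul {r : A} (hr : r ≠ 0) :
    ∃ k : A, k ≠ 0 ∧ ∀ w, ‖r‖ * ‖k * w‖ ≤ 2 * ‖r * k * w‖ := by
  let _ : PartialOrder A := CStarAlgebra.spectralOrder A
  have _ : StarOrderedRing A := CStarAlgebra.spectralOrderedRing A
  have hp : 0 < ‖r‖ := norm_pos_iff.2 hr
  set h := star r * r with hh
  have hs : star h = h := (IsSelfAdjoint.star_mul_self r).star_eq
  have hn : ‖h‖ = ‖r‖ * ‖r‖ := CStarRing.norm_star_mul_self
  have hnot : ¬ star h * h * h ≤ (‖r‖ ^ 2 / 4) • (star h * h) := by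
    intro hle
    have e2 : ‖h * h‖ = ‖h‖ * ‖h‖ := by
      have := CStarRing.norm_star_mul_self (x := h)
      rwa [hs] at this
    have h1 : 0 ≤ star h * h * h := by
      rw [hs]
      simpa [hs] using star_left_conjugate_nonneg (star_mul_self_nonneg r) h
    have h2 := CStarAlgebra.norm_le_norm_of_nonneg_of_le h1 hle
    rw [norm_smul, CStarRing.norm_star_mul_self, Real.norm_of_nonneg (by positivity)] at h2
    have e3 := CStarRing.norm_star_mul_self (x := h * h)
    rw [star_mul, hs, e2, ← mul_assoc] at e3
    have h3 := norm_mul_le (h * h * h) h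
    rw [e3, hn] at h3
    rw [hs, hn] at h2
    nlinarith [pow_pos hp 8, mul_le_mul_of_nonneg_right h2 (mul_self_nonneg ‖r‖)]
  obtain ⟨k, hk, hle⟩ := exists_mul_ne_zero_smul_le (.star_mul_self r) hnot
  refine ⟨h * k, hk, fun w => ?_⟩
  have l1 := star_left_conjugate_le_conjugate hle w
  set y := h * k * w with hy
  have l2 : (‖r‖ ^ 2 / 4) • (star y * y) ≤ star (r * y) * (r * y) := by
    simpa [hy, hh, mul_assoc, mul_smul_comm, smul_mul_assoc] using l1
  have l3 := CStarAlgebra.norm_le_norm_of_nonneg_of_le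
    (smul_nonneg (by positivity) (star_mul_self_nonneg y)) l2
  rw [norm_smul, CStarRing.norm_star_mul_self, CStarRing.norm_star_mul_self,
    Real.norm_of_nonneg (by positivity)] at l3
  rw [mul_assoc, ← hy]
  refine abs_le_of_sq_le_sq' ?_ (by positivity) |>.2
  nlinarith

theorem exists_norm_mul_le_two_mul' {r : A} (hr : r ≠ 0) :
    ∃ k : A, k ≠ 0 ∧ ∀ w, ‖r‖ * ‖w * k‖ ≤ 2 * ‖w * (k * r)‖ := by
  obtain ⟨k, hk, h⟩ := exists_norm_mul_le_two_mul (star_ne_zero.2 hr)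
  refine ⟨star k, star_ne_zero.2 hk, fun w => ?_⟩
  have := h (star w)
  rw [norm_star, ← norm_star (k * _), ← norm_star (_ * _ * _)] at this
  simpa using this

end Excision

theorem exists_mul_mul_ne_zero {A : Type*} [NonUnitalCStarAlgebra A]
    (hA : ∀ I₁ I₂ : TwoSidedIdeal A, (∀ x ∈ I₁, ∀ y ∈ I₂, x * y = 0) → I₁ = ⊥ ∨ I₂ = ⊥)
    {p q : A} (hp : p ≠ 0) (hq : q ≠ 0) : ∃ c, p * c * q ≠ 0 := by
  by_contra! hpq
  let I₁ : TwoSidedIdeal A := .mk' {x | ∀ c, x * c * q = 0} (by simp)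
    (fun hx hy c => by rw [add_mul, add_mul, hx, hy, add_zero])
    (fun hx c => by rw [neg_mul, neg_mul, hx, neg_zero])
    (fun {x y} hy c => by rw [mul_assoc x, mul_assoc x, hy, mul_zero])
    (fun {x y} hx c => by rw [mul_assoc x, hx])
  have h₁ : ∀ x, x ∈ I₁ ↔ ∀ c, x * c * q = 0 := fun x => TwoSidedIdeal.mem_mk' ..
  let I₂ : TwoSidedIdeal A := .mk' {y | ∀ x ∈ I₁, ∀ c, x * c * y = 0} (by simp)
    (fun hx hy z hz c => by rw [mul_add, hx z hz, hy z hz, add_zero])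
    (fun hx z hz c => by rw [mul_neg, hx z hz, neg_zero])
    (fun {x y} hy z hz c => by rw [← mul_assoc, mul_assoc z, hy z hz])
    (fun {x y} hx z hz c => by rw [← mul_assoc, hx z hz, zero_mul])
  have h₂ : ∀ y, y ∈ I₂ ↔ ∀ x ∈ I₁, ∀ c, x * c * y = 0 := fun x => TwoSidedIdeal.mem_mk' ..
  have hprod : ∀ x ∈ I₁, ∀ y ∈ I₂, x * y = 0 := fun x hx y hy => by
    have h1 := (h₂ y).1 hy x hx (star x * x)
    have h2 : star x * x * y = 0 := by
      rw [← CStarRing.star_mul_self_eq_zero_iff]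
      calc _ = star y * star x * (x * (star x * x) * y) := by simp [mul_assoc]
        _ = 0 := by rw [h1, mul_zero]
    rw [← CStarRing.star_mul_self_eq_zero_iff]
    calc _ = star y * (star x * x * y) := by simp [mul_assoc]
      _ = 0 := by rw [h2, mul_zero]
  rcases hA I₁ I₂ hprod with h | h
  · have : p ∈ I₁ := (h₁ p).2 hpq
    exact hp (by rwa [h, TwoSidedIdeal.mem_bot] at this)
  · have : q ∈ I₂ := (h₂ q).2 fun x hx => (h₁ x).1 hx
    exact hq (by rwa [h, TwoSidedIdeal.mem_bot] at this)

section Prime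

variable {A : Type*} [NonUnitalCStarAlgebra A]

theorem norm_le_four_mul_of_forall_norm_mul_mul_le
    (hA : ∀ p q : A, p ≠ 0 → q ≠ 0 → ∃ c, p * c * q ≠ 0) {s t : A} (ht : t ≠ 0) {δ : ℝ}
    (hδ : 0 ≤ δ) (h : ∀ c, ‖s * c * t‖ ≤ δ * ‖c‖ * ‖t‖) : ‖s‖ ≤ 4 * δ := by
  rcases eq_or_ne s 0 with rfl | hs
  · simpa using hδ
  obtain ⟨k, hk, h1⟩ := exists_norm_mul_le_two_mul hs
  obtain ⟨q, hq, h2⟩ := exists_norm_mul_le_two_mul' ht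
  obtain ⟨c, hc⟩ := hA k q hk hq
  have h1 := h1 (c * q)
  have h2 := h2 (s * k * c)
  have h3 := h (k * c * q)
  simp only [← mul_assoc] at h1 h2 h3
  have hn : 0 < ‖k * c * q‖ := norm_pos_iff.2 hc
  have hn' : 0 < ‖t‖ := norm_pos_iff.2 ht
  have h4 : ‖s * k * c * q‖ ≤ 2 * (δ * ‖k * c * q‖) := by
    refine le_of_mul_le_mul_left ?_ hn'
    linarith
  refine le_of_mul_le_mul_right ?_ hn
  linarith

theorem HasSum.norm_sub_sum_le {ι E : Type*} [SeminormedAddCommGroup E] {f : ι → ℝ} {g : ι → E}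
    {L : ℝ} {v : E} (hf : HasSum f L) (hg : HasSum g v) (h : ∀ i, ‖g i‖ ≤ f i) (S : Finset ι) :
    ‖v - ∑ i ∈ S, g i‖ ≤ L - ∑ i ∈ S, f i := by
  classical
  refine le_of_tendsto_of_tendsto (Filter.Tendsto.norm (Filter.Tendsto.sub_const hg _))
    (Filter.Tendsto.sub_const hf _) ?_
  filter_upwards [Filter.eventually_ge_atTop S] with S' hS'
  rw [← Finset.sum_sdiff hS', ← Finset.sum_sdiff hS', add_sub_cancel_right, add_sub_cancel_right]
  exact norm_sum_le_of_le _ fun i _ => h i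

theorem hasSum_apply_smul_eq_zero
    (hA : ∀ p q : A, p ≠ 0 → q ≠ 0 → ∃ c, p * c * q ≠ 0) {ι : Type*} {a c : ι → A}
    (hs : Summable fun i => ‖a i‖ * ‖c i‖) (h0 : ∀ d, HasSum (fun i => a i * d * c i) 0)
    (F : A →L[ℂ] ℂ) : HasSum (fun i => F (a i) • c i) 0 := by
  have hF : ∀ i, ‖F (a i) • c i‖ ≤ ‖F‖ * (‖a i‖ * ‖c i‖) := fun i => by
    rw [norm_smul, ← mul_assoc]
    gcongr
    exact F.le_opNorm _
  obtain ⟨v, hv⟩ : Summable fun i => F (a i) • c i := .of_norm_bounded (hs.mul_left _) hF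
  suffices v = 0 by rwa [this] at hv
  by_contra hv0
  obtain ⟨η, hη, x₀, hx₀, hlow⟩ := exists_compression_lower_bound hv0
  obtain ⟨L, hL⟩ := hs
  obtain ⟨ε, hε, hεη⟩ : ∃ ε > 0, 10 * ε * ‖F‖ < η := by
    refine ⟨η / (10 * (‖F‖ + 1)), by positivity, ?_⟩
    have : 0 ≤ ‖F‖ := norm_nonneg F
    rw [show 10 * (η / (10 * (‖F‖ + 1))) * ‖F‖ = η * (‖F‖ / (‖F‖ + 1)) by field_simp]
    exact mul_lt_of_lt_one_right hη ((div_lt_one (by positivity)).2 (by linarith))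
  obtain ⟨S, hS⟩ : ∃ S : Finset ι, L - ∑ i ∈ S, ‖a i‖ * ‖c i‖ ≤ ε := by
    have : ∀ᶠ S : Finset ι in Filter.atTop, L - ε < ∑ i ∈ S, ‖a i‖ * ‖c i‖ :=
      hL.eventually (lt_mem_nhds (by linarith))
    obtain ⟨S, hS⟩ := this.exists
    exact ⟨S, by linarith⟩
  obtain ⟨τ, hτ, hτS⟩ : ∃ τ > 0, τ * ∑ i ∈ S, ‖a i‖ ≤ ε := by
    have h1 : 0 ≤ ∑ i ∈ S, ‖a i‖ := Finset.sum_nonneg fun i _ => norm_nonneg _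
    refine ⟨ε / (∑ i ∈ S, ‖a i‖ + 1), by positivity, ?_⟩
    rw [div_mul_eq_mul_div, div_le_iff₀ (by positivity)]
    nlinarith
  obtain ⟨k, μ, hk, hexc⟩ := exists_excises_finset hx₀ c S hτ
  obtain ⟨k', hk'⟩ : ∃ k', x₀ * k * k' ≠ 0 := ⟨star (x₀ * k), (CStarRing.mul_star_self_eq_zero_iff _).not.2 hk⟩
  have hexc : ∀ i ∈ S, _ := fun i hi => hexc i hi k'
  have hlow := hlow (k * k')
  rw [← mul_assoc] at hlow
  generalize x₀ * k * k' = x at hk' hexc hlow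
  have hx : 0 < ‖x‖ := norm_pos_iff.2 hk'
  have herr : ∀ (w : ι → A) (M : ℝ), 0 ≤ M →
      (∀ i ∈ S, ‖w i‖ ≤ M * ‖a i‖ * ‖star x * c i * x - μ i • (star x * x)‖) →
      ‖∑ i ∈ S, w i‖ ≤ M * ε * ‖x‖ ^ 2 := fun w M hM hw => by
    calc ‖∑ i ∈ S, w i‖ ≤ ∑ i ∈ S, M * ‖a i‖ * (τ * ‖x‖ ^ 2) :=
          norm_sum_le_of_le _ fun i hi => (hw i hi).trans (by gcongr; exact hexc i hi)
      _ = M * (τ * ∑ i ∈ S, ‖a i‖) * ‖x‖ ^ 2 := by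
          rw [← Finset.sum_mul, ← Finset.mul_sum]; ring
      _ ≤ M * ε * ‖x‖ ^ 2 := by gcongr
  have htail : ∀ (g : ι → A) (u : A) (M : ℝ), 0 ≤ M → HasSum g u →
      (∀ i, ‖g i‖ ≤ M * (‖a i‖ * ‖c i‖)) → ‖u - ∑ i ∈ S, g i‖ ≤ M * ε := fun g u M hM hg hle => by
    refine ((hL.mul_left M).norm_sub_sum_le hg hle S).trans ?_
    rw [← Finset.mul_sum, ← mul_sub]
    gcongr
  have hsn : ‖∑ i ∈ S, μ i • a i‖ ≤ 4 * (2 * ε) := by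
    refine norm_le_four_mul_of_forall_norm_mul_mul_le hA
      (t := star x * x) (by simpa using hk') (by positivity) fun d => ?_
    have e : (∑ i ∈ S, μ i • a i) * d * (star x * x) =
        -∑ i ∈ S, a i * d * (star x * c i * x - μ i • (star x * x)) -
          (0 - ∑ i ∈ S, a i * (d * star x) * c i) * x := by
      rw [zero_sub, neg_mul, sub_neg_eq_add, Finset.sum_mul, Finset.sum_mul, Finset.sum_mul,
        ← Finset.sum_neg_distrib, ← Finset.sum_add_distrib]
      refine Finset.sum_congr rfl fun i _ => ?_
      simp only [mul_sub, mul_smul_comm, smul_mul_assoc, mul_assoc]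
      abel
    have h1 := herr (fun i => a i * d * (star x * c i * x - μ i • (star x * x))) ‖d‖
      (norm_nonneg _) fun i _ => (norm_mul_le _ _).trans (by
        gcongr
        rw [mul_comm ‖d‖]
        exact norm_mul_le _ _)
    have h2 := htail _ _ (‖d‖ * ‖x‖) (by positivity) (h0 (d * star x)) fun i => by
      calc _ ≤ ‖a i‖ * (‖d‖ * ‖star x‖) * ‖c i‖ := norm_mul₃_le.trans (by
            gcongr; exact norm_mul_le _ _)
        _ = _ := by rw [norm_star]; ring
    rw [e, CStarRing.norm_star_mul_self]
    refine (norm_sub_le _ _).trans ?_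
    rw [norm_neg]
    have h3 := (norm_mul_le (0 - ∑ i ∈ S, a i * (d * star x) * c i) x).trans
      (mul_le_mul_of_nonneg_right h2 hx.le)
    nlinarith
  have hb1 := herr (fun i => F (a i) • (star x * c i * x - μ i • (star x * x))) ‖F‖
    (norm_nonneg _) fun i _ => by
      rw [norm_smul]
      gcongr
      exact F.le_opNorm _
  have hb2 := htail _ _ ‖F‖ (norm_nonneg _) hv hF
  have hb3 : ‖F (∑ i ∈ S, μ i • a i)‖ ≤ ‖F‖ * (4 * (2 * ε)) :=
    (F.le_opNorm _).trans (by gcongr)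
  have e : star x * v * x = star x * (v - ∑ i ∈ S, F (a i) • c i) * x +
      ∑ i ∈ S, F (a i) • (star x * c i * x - μ i • (star x * x)) +
      F (∑ i ∈ S, μ i • a i) • (star x * x) := by
    simp only [mul_sub, sub_mul, Finset.mul_sum, Finset.sum_mul, map_sum, map_smul, smul_sub,
      Finset.sum_sub_distrib, mul_smul_comm, smul_mul_assoc, Finset.sum_smul, smul_smul,
      smul_eq_mul, mul_comm (F _)]
    abel
  rw [e] at hlow
  have h4 : ‖star x * (v - ∑ i ∈ S, F (a i) • c i) * x‖ ≤ ‖x‖ * (‖F‖ * ε) * ‖x‖ :=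
    norm_mul₃_le.trans (by rw [norm_star]; gcongr)
  have h5 : ‖F (∑ i ∈ S, μ i • a i) • (star x * x)‖ ≤ ‖F‖ * (4 * (2 * ε)) * (‖x‖ * ‖x‖) := by
    rw [norm_smul, CStarRing.norm_star_mul_self]
    gcongr
  have h6 := hlow.trans norm_add₃_le
  have : η * ‖x‖ ^ 2 ≤ 10 * ε * ‖F‖ * ‖x‖ ^ 2 := by nlinarith
  exact absurd (le_of_mul_le_mul_right this (by positivity)) (not_le.2 hεη)

end Prime

namespace CStarProjTensor

variable {A B : Type u} [NonUnitalCStarAlgebra A] [NonUnitalCStarAlgebra B]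

theorem exists_summable_series (P : CStarProjTensor A B) (x : P.T) :
    ∃ (a : A × B → A) (b : A × B → B), (Summable fun n => ‖a n‖ * ‖b n‖) ∧
      HasSum (fun n => P.tmul (a n) (b n)) x := by
  obtain ⟨a, b, ha, hb, h⟩ := P.exists_series x
  refine ⟨a, b, .of_nonneg_of_le (fun n => by positivity) (fun n => ?_) (ha.add hb), h⟩
  nlinarith [sq_nonneg (‖a n‖ - ‖b n‖), sq_nonneg (‖a n‖ + ‖b n‖)]

theorem sliceLeft_mul_mul_sliceLeft_eq_zero (P : CStarProjTensor A B)
    (hA : ∀ p q : A, p ≠ 0 → q ≠ 0 → ∃ c, p * c * q ≠ 0) {x y : P.T} (h : ∀ t, x * t * y = 0)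
    (F G : A →L[ℂ] ℂ) (d : B) : P.sliceLeft F x * d * P.sliceLeft G y = 0 := by
  obtain ⟨a, b, hab, hx⟩ := P.exists_summable_series x
  obtain ⟨a', b', hab', hy⟩ := P.exists_summable_series y
  have hs : Summable fun p : (A × B) × (A × B) =>
      ‖a p.1‖ * ‖b p.1‖ * (‖a' p.2‖ * ‖b' p.2‖) :=
    hab.mul_of_nonneg hab' (fun _ => by positivity) fun _ => by positivity
  refine SeparatingDual.eq_zero_of_forall_dual_eq_zero (R := ℂ) fun (g : B →L[ℂ] ℂ) => ?_
  have hkey : HasSum (fun p : (A × B) × (A × B) =>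
      F (g (b p.1 * d * b' p.2) • a p.1) • a' p.2) 0 := by
    refine hasSum_apply_smul_eq_zero hA ?_ (fun c => ?_) F
    · refine .of_nonneg_of_le (fun p => by positivity) (fun p => ?_) (hs.mul_left (‖g‖ * ‖d‖))
      rw [norm_smul]
      calc _ ≤ ‖g‖ * (‖b p.1‖ * ‖d‖ * ‖b' p.2‖) * ‖a p.1‖ * ‖a' p.2‖ := by
            gcongr
            exact (g.le_opNorm _).trans (by gcongr; exact norm_mul₃_le)
        _ = _ := by ring
    · have h1 := ((hx.mul_right (P.tmul c d)).mul hy (by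
        refine .of_norm_bounded (hs.mul_left (‖c‖ * ‖d‖)) fun p => ?_
        refine norm_mul₃_le.trans (le_of_eq ?_)
        simp only [P.norm_tmul]
        ring)).mapL (P.sliceRight g)
      rw [h, map_zero] at h1
      refine h1.congr_fun fun p => ?_
      rw [P.tmul_mul, P.tmul_mul, P.sliceRight_tmul, smul_mul_assoc, smul_mul_assoc]
  have h1 := hkey.mapL G
  have h2 := (((hx.mapL (P.sliceLeft F)).mul_right d).mul (hy.mapL (P.sliceLeft G)) (by
    refine .of_norm_bounded (hs.mul_left (‖F‖ * ‖G‖ * ‖d‖)) fun p => ?_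
    refine norm_mul₃_le.trans ?_
    rw [P.sliceLeft_tmul, P.sliceLeft_tmul, norm_smul, norm_smul]
    calc _ ≤ (‖F‖ * ‖a p.1‖) * ‖b p.1‖ * ‖d‖ * ((‖G‖ * ‖a' p.2‖) * ‖b' p.2‖) := by
          gcongr <;> exact ContinuousLinearMap.le_opNorm _ _
      _ = _ := by ring)).mapL g
  rw [map_zero] at h1
  refine h2.unique (h1.congr_fun fun p => ?_)
  simp only [P.sliceLeft_tmul, smul_mul_assoc, mul_smul_comm, map_smul, smul_eq_mul]
  ring

end CStarProjTensor

/-- If `A` and `B` are prime C*-algebras (whenever two two-sided ideals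
have product zero, one of them is zero), then the projective tensor product `A ⊗̂ B` is
prime. -/
theorem projTensor_prime {A B : Type u}
    [NonUnitalCStarAlgebra A] [NonUnitalCStarAlgebra B]
    (hA : ∀ I₁ I₂ : TwoSidedIdeal A, (∀ x ∈ I₁, ∀ y ∈ I₂, x * y = 0) → I₁ = ⊥ ∨ I₂ = ⊥)
    (hB : ∀ I₁ I₂ : TwoSidedIdeal B, (∀ x ∈ I₁, ∀ y ∈ I₂, x * y = 0) → I₁ = ⊥ ∨ I₂ = ⊥)
    (P : CStarProjTensor A B) :
    ∀ I₁ I₂ : TwoSidedIdeal P.T, (∀ x ∈ I₁, ∀ y ∈ I₂, x * y = 0) → I₁ = ⊥ ∨ I₂ = ⊥ := by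
  intro I₁ I₂ hI
  by_contra! hne
  obtain ⟨x, hx, hx0⟩ : ∃ x ∈ I₁, x ≠ 0 := by
    by_contra! h
    exact hne.1 (le_bot_iff.1 fun x hx => (TwoSidedIdeal.mem_bot _).2 (h x hx))
  obtain ⟨y, hy, hy0⟩ : ∃ y ∈ I₂, y ≠ 0 := by
    by_contra! h
    exact hne.2 (le_bot_iff.1 fun x hx => (TwoSidedIdeal.mem_bot _).2 (h x hx))
  obtain ⟨F, hF⟩ : ∃ F, P.sliceLeft F x ≠ 0 := by
    by_contra! h
    exact hx0 (P.eq_zero_of_sliceLeft_eq_zero h)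
  obtain ⟨G, hG⟩ : ∃ G, P.sliceLeft G y ≠ 0 := by
    by_contra! h
    exact hy0 (P.eq_zero_of_sliceLeft_eq_zero h)
  obtain ⟨d, hd⟩ := exists_mul_mul_ne_zero hB hF hG
  exact hd (P.sliceLeft_mul_mul_sliceLeft_eq_zero (fun _ _ => exists_mul_mul_ne_zero hA)
    (fun t => hI _ (I₁.mul_mem_right _ _ hx) _ hy) F G d)
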